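/- arXiv:1903.09534 — 5 statements merged into one kernel-verified Lean document; each statement's English description precedes it below -/
import Mathlib

section
/- Under assumption (H1), the function J : Ω → ℝ, J(x,y) := min_{v ∈ B(x)} φ(x,y,v), is well-defined (i.e., for every (x,y) ∈ Ω the minimum of v ↦ φ(x,y,v) over the nonempty compact set B(x) is attained), and J is lower semicontinuous on Ω: for every (x̄,ȳ) ∈ Ω, liminf_{(x,y)→(x̄,ȳ), (x,y)∈Ω} J(x,y) ≥ J(x̄,ȳ). -/
open MvPolynomial Set

/-- If the feasible-set graph `G` is closed with fibres over `S` inside a compact set, and the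
continuous objective `f` attains its minimum `J x` over the fibre at each `x ∈ S`, then `J` is
lower semicontinuous on `S`. -/
theorem lowerSemicontinuousOn_of_isLeast_image {X V : Type*} [TopologicalSpace X]
    [TopologicalSpace V] {S : Set X} {K : Set V} (hK : IsCompact K) {G : Set (X × V)}
    (hG : IsClosed G) (hGK : ∀ x ∈ S, ∀ v, (x, v) ∈ G → v ∈ K) {f : X × V → ℝ}
    (hf : Continuous f) {J : X → ℝ}
    (hJ : ∀ x ∈ S, IsLeast ((fun v => f (x, v)) '' {v | (x, v) ∈ G}) (J x)) :
    LowerSemicontinuousOn J S := by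
  intro x₀ hx₀ c hc
  have hopen : IsOpen (Gᶜ ∪ {p | c < f p}) :=
    hG.isOpen_compl.union (isOpen_lt continuous_const hf)
  have hev : ∀ᶠ x in nhds x₀, ∀ v ∈ K, (x, v) ∈ Gᶜ ∪ {p | c < f p} := by
    refine hK.eventually_forall_of_forall_eventually fun v _ => hopen.mem_nhds ?_
    by_cases hv : (x₀, v) ∈ G
    · exact Or.inr (hc.trans_le ((hJ x₀ hx₀).2 ⟨v, hv, rfl⟩))
    · exact Or.inl hv
  filter_upwards [mem_nhdsWithin_of_mem_nhds hev, self_mem_nhdsWithin] with x hx hxS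
  obtain ⟨v, hv, hvJ⟩ := (hJ x hxS).1
  rw [← hvJ]
  exact (hx v (hGK x hxS v hv)).resolve_left fun hn => hn hv

/-- Under assumption (H1), the function
`J(x,y) := min_{v ∈ B(x)} φ(x,y,v)` is well-defined (the minimum is attained for every
`(x,y) ∈ Ω`) and `J` is lower semicontinuous on `Ω`. Points `(x,y) ∈ ℝⁿ × ℝᵐ` are encoded
as functions `z : Fin n ⊕ Fin m → ℝ`, with `x = z ∘ Sum.inl` and `y = z ∘ Sum.inr`. -/
theorem statement_0 (n m s : ℕ)
    (h : Fin s → MvPolynomial (Fin n ⊕ Fin m) ℝ)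
    (φ : MvPolynomial (Fin n ⊕ (Fin m ⊕ Fin m)) ℝ)
    -- the sets B(x) ⊆ ℝᵐ
    (Bx : (Fin n → ℝ) → Set (Fin m → ℝ))
    (hBx : ∀ x, Bx x = {v | ∀ j, 0 ≤ eval (Sum.elim x v) (h j)})
    -- the set B ⊆ ℝⁿ × ℝᵐ
    (B : Set (Fin n ⊕ Fin m → ℝ))
    (hB : B = {z | ∀ j, 0 ≤ eval z (h j)})
    -- assumption (H1)
    (Ω : Set (Fin n ⊕ Fin m → ℝ))
    (hΩc : IsCompact Ω) (hBΩ : B ⊆ Ω)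
    (hne : ∀ x ∈ (fun z : Fin n ⊕ Fin m → ℝ => z ∘ Sum.inl) '' Ω, (Bx x).Nonempty)
    -- the optimal value function J, defined as an infimum
    (J : (Fin n ⊕ Fin m → ℝ) → ℝ)
    (hJ : ∀ z : Fin n ⊕ Fin m → ℝ,
      J z = sInf ((fun v => eval (Sum.elim (z ∘ Sum.inl) (Sum.elim (z ∘ Sum.inr) v)) φ) ''
        Bx (z ∘ Sum.inl))) :
    -- J is well-defined: at every point of Ω the minimum is attained and equals J,
    -- and J is lower semicontinuous on Ω
    (∀ z ∈ Ω, IsLeast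
      ((fun v => eval (Sum.elim (z ∘ Sum.inl) (Sum.elim (z ∘ Sum.inr) v)) φ) ''
        Bx (z ∘ Sum.inl)) (J z)) ∧
    LowerSemicontinuousOn J Ω := by
  have hBK : ∀ x, Bx x ⊆ (fun z : Fin n ⊕ Fin m → ℝ => z ∘ Sum.inr) '' Ω := by
    intro x v hv
    rw [hBx] at hv
    exact ⟨Sum.elim x v, hBΩ (hB ▸ hv), Sum.elim_comp_inr x v⟩
  have hK : IsCompact ((fun z : Fin n ⊕ Fin m → ℝ => z ∘ Sum.inr) '' Ω) :=
    hΩc.image (by fun_prop)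
  have hG : IsClosed {p : (Fin n ⊕ Fin m → ℝ) × (Fin m → ℝ) | p.2 ∈ Bx (p.1 ∘ Sum.inl)} := by
    have hinter : {p : (Fin n ⊕ Fin m → ℝ) × (Fin m → ℝ) | p.2 ∈ Bx (p.1 ∘ Sum.inl)} =
        ⋂ j, {p | 0 ≤ eval (Sum.elim (p.1 ∘ Sum.inl) p.2) (h j)} := by
      ext p
      simp [hBx]
    rw [hinter]
    refine isClosed_iInter fun j => isClosed_le continuous_const ?_
    refine (continuous_eval (h j)).comp (continuous_pi ?_)
    rintro (i | i) <;> simp only [Sum.elim_inl, Sum.elim_inr, Function.comp_apply] <;> fun_prop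
  have hf : Continuous fun p : (Fin n ⊕ Fin m → ℝ) × (Fin m → ℝ) =>
      eval (Sum.elim (p.1 ∘ Sum.inl) (Sum.elim (p.1 ∘ Sum.inr) p.2)) φ := by
    refine (continuous_eval φ).comp (continuous_pi ?_)
    rintro (i | i | i) <;> simp only [Sum.elim_inl, Sum.elim_inr, Function.comp_apply] <;> fun_prop
  have hmin : ∀ z ∈ Ω, IsLeast
      ((fun v => eval (Sum.elim (z ∘ Sum.inl) (Sum.elim (z ∘ Sum.inr) v)) φ) ''
        Bx (z ∘ Sum.inl)) (J z) := by
    intro z hz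
    have hclosed : IsClosed (Bx (z ∘ Sum.inl)) := hG.preimage (Continuous.prodMk_right z)
    have hcompact := (hK.of_isClosed_subset hclosed (hBK _)).image
      (hf.comp (Continuous.prodMk_right z))
    rw [hJ]
    exact hcompact.isLeast_sInf ((hne _ ⟨z, hz, rfl⟩).image _)
  exact ⟨hmin, lowerSemicontinuousOn_of_isLeast_image hK hG (fun _ _ _ hv => hBK _ hv) hf hmin⟩
end

section
/- Suppose assumption (H1) holds with Ω semi-algebraic and the feasible set {(x,y) ∈ A ∩ B : J(x,y) ≥ 0} of problem (P) is nonempty. Then the value function [0,∞) → ℝ, ε ↦ val(P_ε), is a semi-algebraic function; in particular, it is real-analytic on [0,∞) except at finitely many points. -/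
open MvPolynomial Set

/-- A set `S ⊆ ℝ^ι` is semi-algebraic if it is a finite union of sets each given by
finitely many polynomial equations `p = 0` and finitely many strict polynomial
inequalities `p > 0`. -/
def IsSemialgebraic {ι : Type} (S : Set (ι → ℝ)) : Prop :=
  ∃ (q : ℕ) (E P : Fin q → Finset (MvPolynomial ι ℝ)),
    S = ⋃ i : Fin q, {z | (∀ p ∈ E i, MvPolynomial.eval z p = 0) ∧
      ∀ p ∈ P i, 0 < MvPolynomial.eval z p}

section

open Filter Topology Polynomial.Bivariate

theorem exists_orderIso_stretch {c d e : ℝ} (hd : c < d) (he : c < e) :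
    ∃ ψ : ℝ ≃o ℝ, (∀ y ≤ c, ψ y = y) ∧ ψ d = e := by
  set k : ℝ := (e - c) / (d - c) with hk
  have hk0 : 0 < k := div_pos (by linarith) (by linarith)
  let F : ℝ → ℝ := fun y => if y ≤ c then y else c + (y - c) * k
  have hmono : StrictMono F := by
    intro a b hab
    simp only [F]
    split_ifs with h1 h2 h2
    · exact hab
    · have : 0 < (b - c) * k := mul_pos (by linarith) hk0
      linarith
    · linarith
    · nlinarith
  have hsurj : Function.Surjective F := by
    intro y
    by_cases hy : y ≤ c
    · exact ⟨y, if_pos hy⟩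
    · refine ⟨c + (y - c) / k, ?_⟩
      have : 0 < (y - c) / k := div_pos (by linarith) hk0
      simp only [F]
      rw [if_neg (by linarith)]
      field_simp
      ring
  refine ⟨hmono.orderIsoOfSurjective F hsurj, fun y hy => ?_, ?_⟩
  · simp [F, hy]
  · have : d - c ≠ 0 := by linarith
    simp only [StrictMono.coe_orderIsoOfSurjective, F]
    rw [if_neg (by linarith), hk]
    field_simp
    ring

/-- A strictly increasing map on a finite set of reals extends to an order automorphism of `ℝ`. -/
theorem exists_orderIso_extending (W : Finset ℝ) (η : ℝ → ℝ) (h : StrictMonoOn η W) :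
    ∃ θ : ℝ ≃o ℝ, ∀ w ∈ W, θ w = η w := by
  induction W using Finset.induction_on_max with
  | empty => exact ⟨OrderIso.refl ℝ, by simp⟩
  | insert a s ha ih =>
    obtain ⟨θ, hθ⟩ := ih (h.mono (by simp))
    rcases s.eq_empty_or_nonempty with rfl | hs
    · refine ⟨OrderIso.addRight (η a - a), ?_⟩
      simp
    · have hM := s.max'_mem hs
      set M := s.max' hs with hMdef
      obtain ⟨ψ, h1, h2⟩ := exists_orderIso_stretch (c := θ M) (d := θ a) (e := η a)
        (θ.strictMono (ha _ hM))
        (by rw [hθ _ hM]; exact h (by simp [hM]) (by simp) (ha _ hM))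
      refine ⟨θ.trans ψ, fun w hw => ?_⟩
      rcases Finset.mem_insert.1 hw with rfl | hw
      · simpa using h2
      · rw [OrderIso.trans_apply, h1, hθ _ hw]
        exact θ.monotone (s.le_max' _ hw)

/-- `x` and `y` lie in the same cell of the decomposition of `ℝ` cut out by the points of `Z`. -/
def SameCell (Z : Finset ℝ) (x y : ℝ) : Prop :=
  ∀ z ∈ Z, (z < x ↔ z < y) ∧ (x < z ↔ y < z)

theorem SameCell.refl (Z : Finset ℝ) (x : ℝ) : SameCell Z x x := fun _ _ => ⟨Iff.rfl, Iff.rfl⟩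

theorem SameCell.symm {Z : Finset ℝ} {x y : ℝ} (h : SameCell Z x y) : SameCell Z y x :=
  fun z hz => ⟨(h z hz).1.symm, (h z hz).2.symm⟩

theorem SameCell.trans {Z : Finset ℝ} {x y w : ℝ} (h : SameCell Z x y) (h' : SameCell Z y w) :
    SameCell Z x w :=
  fun z hz => ⟨(h z hz).1.trans (h' z hz).1, (h z hz).2.trans (h' z hz).2⟩

theorem SameCell.eq_of_mem {Z : Finset ℝ} {x y : ℝ} (h : SameCell Z x y) (hx : x ∈ Z) : y = x :=
  le_antisymm (not_lt.1 fun hl => lt_irrefl x ((h x hx).1.2 hl))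
    (not_lt.1 fun hl => lt_irrefl x ((h x hx).2.2 hl))

theorem SameCell.between {Z : Finset ℝ} {x a b y : ℝ} (ha : SameCell Z x a) (hb : SameCell Z x b)
    (h1 : a ≤ y) (h2 : y ≤ b) : SameCell Z x y := by
  intro z hz
  obtain ⟨a1, a2⟩ := ha z hz
  obtain ⟨b1, b2⟩ := hb z hz
  refine ⟨⟨fun h => (a1.1 h).trans_le h1, fun h => b1.2 (h.trans_le h2)⟩,
    ⟨fun h => h2.trans_lt (b2.1 h), fun h => a2.2 (h1.trans_lt h)⟩⟩

/-- Sign patterns can be matched globally once they can be matched on each cell. -/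
theorem exists_orderIso_of_cells (Z : Finset ℝ) (f g : ℝ → ℝ)
    (H : ∀ x₀, ∃ w w', SameCell Z x₀ w ∧ SameCell Z x₀ w' ∧ ∀ x y, SameCell Z x₀ x →
      SameCell Z x₀ y → (x < w ↔ y < w') → (w < x ↔ w' < y) →
      SignType.sign (f x) = SignType.sign (g y)) :
    ∃ ψ : ℝ ≃o ℝ, (∀ z ∈ Z, ψ z = z) ∧
      ∀ x, SignType.sign (f x) = SignType.sign (g (ψ x)) := by
  classical
  choose w w' hw hw' hsign using H
  let key : ℝ → Finset ℝ × Finset ℝ := fun x => (Z.filter (· < x), Z.filter (x < ·))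
  have key_iff : ∀ x y, key x = key y ↔ SameCell Z x y := by
    intro x y
    simp only [key, Prod.mk.injEq, Finset.ext_iff, Finset.mem_filter, SameCell]
    grind
  let rep : Finset ℝ × Finset ℝ → ℝ := Function.invFun key
  have hrep : ∀ x, SameCell Z x (rep (key x)) := fun x =>
    ((key_iff _ _).1 (Function.invFun_eq (f := key) ⟨x, rfl⟩)).symm
  have hfin : (Set.range fun x => w (rep (key x))).Finite := by
    refine Set.Finite.subset (((Z.powerset ×ˢ Z.powerset).finite_toSet).image
      (fun k => w (rep k))) ?_
    rintro _ ⟨x, rfl⟩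
    exact ⟨key x, by simp [key, Set.subset_def]; grind, rfl⟩
  let W := hfin.toFinset
  let η : ℝ → ℝ := fun u => w' (rep (key u))
  have hη : ∀ u, SameCell Z u (η u) := fun u => (hrep u).trans (hw' _)
  have hW : ∀ u ∈ W, w (rep (key u)) = u := by
    intro u hu
    obtain ⟨x, rfl⟩ := (Set.Finite.mem_toFinset hfin).1 hu
    have : key (w (rep (key x))) = key x :=
      ((key_iff _ _).2 ((hrep x).trans (hw _))).symm
    simp only [this]
  have hmono : StrictMonoOn η W := by
    intro u hu v hv huv
    have hne : ¬ SameCell Z u v := by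
      intro hs
      have := (key_iff _ _).2 hs
      have h1 := hW u hu
      rw [this, hW v hv] at h1
      exact huv.ne' h1
    by_contra hcon
    apply hne
    intro z hz
    have hu' := hη u z hz
    have hv' := hη v z hz
    grind
  obtain ⟨ψ, hψ⟩ := exists_orderIso_extending W η hmono
  have hZ : ∀ z ∈ Z, ψ z = z := by
    intro z hz
    have h1 : w (rep (key z)) = z := ((hrep z).trans (hw _)).eq_of_mem hz
    rw [hψ z ((Set.Finite.mem_toFinset hfin).2 ⟨z, h1⟩)]
    exact (hη z).eq_of_mem hz
  have hcell : ∀ x, SameCell Z x (ψ x) := by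
    intro x z hz
    conv_lhs => rw [← ψ.lt_iff_lt, hZ z hz]
    refine ⟨Iff.rfl, ?_⟩
    conv_lhs => rw [← ψ.lt_iff_lt, hZ z hz]
  refine ⟨ψ, hZ, fun x => ?_⟩
  have hx := hrep x
  have hmem : w (rep (key x)) ∈ W := (Set.Finite.mem_toFinset hfin).2 ⟨x, rfl⟩
  have hval : ψ (w (rep (key x))) = w' (rep (key x)) := by
    rw [hψ _ hmem]
    simp only [η]
    rw [(key_iff _ _).2 (hx.trans (hw _)).symm]
  refine hsign (rep (key x)) x (ψ x) hx.symm (hx.symm.trans (hcell x)) ?_ ?_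
  · rw [← hval, ψ.lt_iff_lt]
  · rw [← hval, ψ.lt_iff_lt]

theorem pos_on_cell_of_pos {Z : Finset ℝ} {f g : ℝ → ℝ} {x₀ : ℝ} (hx₀ : x₀ ∉ Z)
    (hf : Continuous f) (hfu : ∀ M, ∃ y < x₀, M < |f y|)
    (hfm : ∀ a b, a < b → (∀ x ∈ Ioo a b, SameCell Z x₀ x) → f a < f b)
    (hgm : ∀ a b, a < b → (∀ x ∈ Ioo a b, SameCell Z x₀ x) → g a < g b)
    (hZ : ∀ z ∈ Z, SignType.sign (f z) = SignType.sign (g z))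
    (hpos : ∀ x, SameCell Z x₀ x → 0 < f x) : ∀ x, SameCell Z x₀ x → 0 < g x := by
  intro x hx
  by_cases hne : (Z.filter (· < x₀)).Nonempty
  · have hz := (Z.filter (· < x₀)).max'_mem hne
    have hmax := fun y hy => (Z.filter (· < x₀)).le_max' y hy
    set z := (Z.filter (· < x₀)).max' hne
    rw [Finset.mem_filter] at hz
    have key : ∀ u, SameCell Z x₀ u → ∀ y ∈ Ioo z u, SameCell Z x₀ y := by
      intro u hu y hy t ht
      obtain ⟨h1, h2⟩ := hu t ht
      have h3 : t < x₀ → t ≤ z := fun h => hmax t (by simp [ht, h])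
      have h4 : t ≠ x₀ := fun h => hx₀ (h ▸ ht)
      have := hy.1
      have := hy.2
      grind
    have hfz : 0 ≤ f z := by
      have : Tendsto f (nhdsWithin z (Ioi z)) (nhds (f z)) := hf.continuousAt.tendsto.mono_left
        nhdsWithin_le_nhds
      refine ge_of_tendsto this ?_
      filter_upwards [Ioo_mem_nhdsGT hz.2] with y hy
      exact (hpos y (key x₀ (SameCell.refl _ _) y hy)).le
    have hgz : 0 ≤ g z := by
      rw [← sign_nonneg_iff] at hfz ⊢
      rwa [← hZ z hz.1]
    exact hgz.trans_lt (hgm z x (((hx z hz.1).1).1 hz.2) (key x hx))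
  · exfalso
    rw [Finset.not_nonempty_iff_eq_empty, Finset.filter_eq_empty_iff] at hne
    have key : ∀ y ≤ x₀, SameCell Z x₀ y := by
      intro y hy t ht
      have := hne ht
      have h4 : t ≠ x₀ := fun h => hx₀ (h ▸ ht)
      grind
    obtain ⟨y, hy, hM⟩ := hfu (f x₀)
    have h1 := hpos y (key y hy.le)
    rw [abs_of_pos h1] at hM
    exact absurd (hfm y x₀ hy fun u hu => key u hu.2.le) (by linarith)

theorem neg_on_cell_of_neg {Z : Finset ℝ} {f g : ℝ → ℝ} {x₀ : ℝ} (hx₀ : x₀ ∉ Z)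
    (hf : Continuous f) (hfu : ∀ M, ∃ y > x₀, M < |f y|)
    (hfm : ∀ a b, a < b → (∀ x ∈ Ioo a b, SameCell Z x₀ x) → f a < f b)
    (hgm : ∀ a b, a < b → (∀ x ∈ Ioo a b, SameCell Z x₀ x) → g a < g b)
    (hZ : ∀ z ∈ Z, SignType.sign (f z) = SignType.sign (g z))
    (hneg : ∀ x, SameCell Z x₀ x → f x < 0) : ∀ x, SameCell Z x₀ x → g x < 0 := by
  intro x hx
  by_cases hne : (Z.filter (x₀ < ·)).Nonempty
  · have hz := (Z.filter (x₀ < ·)).min'_mem hne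
    have hmin := fun y hy => (Z.filter (x₀ < ·)).min'_le y hy
    set z := (Z.filter (x₀ < ·)).min' hne
    rw [Finset.mem_filter] at hz
    have key : ∀ u, SameCell Z x₀ u → ∀ y ∈ Ioo u z, SameCell Z x₀ y := by
      intro u hu y hy t ht
      obtain ⟨h1, h2⟩ := hu t ht
      have h3 : x₀ < t → z ≤ t := fun h => hmin t (by simp [ht, h])
      have h4 : t ≠ x₀ := fun h => hx₀ (h ▸ ht)
      have := hy.1
      have := hy.2
      grind
    have hfz : f z ≤ 0 := by
      have : Tendsto f (nhdsWithin z (Iio z)) (nhds (f z)) := hf.continuousAt.tendsto.mono_left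
        nhdsWithin_le_nhds
      refine le_of_tendsto this ?_
      filter_upwards [Ioo_mem_nhdsLT hz.2] with y hy
      exact (hneg y (key x₀ (SameCell.refl _ _) y hy)).le
    have hgz : g z ≤ 0 := by
      rw [← sign_nonpos_iff] at hfz ⊢
      rwa [← hZ z hz.1]
    exact (hgm x z (((hx z hz.1).2).1 hz.2) (key x hx)).trans_le hgz
  · exfalso
    rw [Finset.not_nonempty_iff_eq_empty, Finset.filter_eq_empty_iff] at hne
    have key : ∀ y, x₀ ≤ y → SameCell Z x₀ y := by
      intro y hy t ht
      have := hne ht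
      have h4 : t ≠ x₀ := fun h => hx₀ (h ▸ ht)
      grind
    obtain ⟨y, hy, hM⟩ := hfu (-f x₀)
    have h1 := hneg y (key y (le_of_lt hy))
    rw [abs_of_neg h1] at hM
    exact absurd (hfm x₀ y hy fun u hu => key u hu.1.le) (by linarith)

theorem exists_cell_matching_of_increasing {Z : Finset ℝ} {f g : ℝ → ℝ} {x₀ : ℝ} (hx₀ : x₀ ∉ Z)
    (hf : Continuous f) (hg : Continuous g)
    (hfu : ∀ M, (∃ y < x₀, M < |f y|) ∧ ∃ y > x₀, M < |f y|)
    (hgu : ∀ M, (∃ y < x₀, M < |g y|) ∧ ∃ y > x₀, M < |g y|)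
    (hfm : ∀ a b, a < b → (∀ x ∈ Ioo a b, SameCell Z x₀ x) → f a < f b)
    (hgm : ∀ a b, a < b → (∀ x ∈ Ioo a b, SameCell Z x₀ x) → g a < g b)
    (hZ : ∀ z ∈ Z, SignType.sign (f z) = SignType.sign (g z)) :
    ∃ w w', SameCell Z x₀ w ∧ SameCell Z x₀ w' ∧ ∀ x y, SameCell Z x₀ x →
      SameCell Z x₀ y → (x < w ↔ y < w') → (w < x ↔ w' < y) →
      SignType.sign (f x) = SignType.sign (g y) := by
  have hZ' : ∀ z ∈ Z, SignType.sign (g z) = SignType.sign (f z) := fun z hz => (hZ z hz).symm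
  have dich : ∀ f : ℝ → ℝ, Continuous f → (¬ ∃ w, SameCell Z x₀ w ∧ f w = 0) →
      (∀ x, SameCell Z x₀ x → 0 < f x) ∨ (∀ x, SameCell Z x₀ x → f x < 0) := by
    intro f hf hno
    by_contra hcon
    push Not at hcon hno
    obtain ⟨⟨a, ha, ha0⟩, b, hb, hb0⟩ := hcon
    have hord : {x | SameCell Z x₀ x}.OrdConnected :=
      ⟨fun a ha b hb y hy => ha.between hb hy.1 hy.2⟩
    obtain ⟨w, hw, hw0⟩ := hord.isPreconnected.intermediate_value ha hb hf.continuousOn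
      (show (0 : ℝ) ∈ Icc (f a) (f b) from ⟨ha0, hb0⟩)
    exact hno w hw hw0
  have both_pos : (∀ x, SameCell Z x₀ x → 0 < f x) → (∀ x, SameCell Z x₀ x → 0 < g x) →
      ∃ w w', SameCell Z x₀ w ∧ SameCell Z x₀ w' ∧ ∀ x y, SameCell Z x₀ x →
      SameCell Z x₀ y → (x < w ↔ y < w') → (w < x ↔ w' < y) →
      SignType.sign (f x) = SignType.sign (g y) := fun h1 h2 =>
    ⟨x₀, x₀, .refl _ _, .refl _ _, fun x y hx hy _ _ => by
      rw [sign_pos (h1 x hx), sign_pos (h2 y hy)]⟩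
  have both_neg : (∀ x, SameCell Z x₀ x → f x < 0) → (∀ x, SameCell Z x₀ x → g x < 0) →
      ∃ w w', SameCell Z x₀ w ∧ SameCell Z x₀ w' ∧ ∀ x y, SameCell Z x₀ x →
      SameCell Z x₀ y → (x < w ↔ y < w') → (w < x ↔ w' < y) →
      SignType.sign (f x) = SignType.sign (g y) := fun h1 h2 =>
    ⟨x₀, x₀, .refl _ _, .refl _ _, fun x y hx hy _ _ => by
      rw [sign_neg (h1 x hx), sign_neg (h2 y hy)]⟩
  by_cases h1 : ∃ w, SameCell Z x₀ w ∧ f w = 0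
  · by_cases h2 : ∃ w, SameCell Z x₀ w ∧ g w = 0
    · obtain ⟨w, hw, hw0⟩ := h1
      obtain ⟨w', hw', hw0'⟩ := h2
      have fin : ∀ h : ℝ → ℝ, (∀ a b, a < b → (∀ x ∈ Ioo a b, SameCell Z x₀ x) → h a < h b) →
          ∀ a b, SameCell Z x₀ a → SameCell Z x₀ b → a < b → h a < h b :=
        fun h hm a b ha hb hab => hm a b hab fun x hx => ha.between hb hx.1.le hx.2.le
      refine ⟨w, w', hw, hw', fun x y hx hy hl hr => ?_⟩
      rcases lt_trichotomy x w with h | h | h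
      · have a1 := fin f hfm x w hx hw h
        have a2 := fin g hgm y w' hy hw' (hl.1 h)
        rw [sign_neg (by linarith), sign_neg (by linarith)]
      · subst h
        have : y = w' := le_antisymm (not_lt.1 fun h => lt_irrefl _ (hr.2 h))
          (not_lt.1 fun h => lt_irrefl _ (hl.2 h))
        rw [hw0, this, hw0']
      · have a1 := fin f hfm w x hw hx h
        have a2 := fin g hgm w' y hw' hy (hr.1 h)
        rw [sign_pos (by linarith), sign_pos (by linarith)]
    · rcases dich g hg h2 with h | h
      · exact both_pos (pos_on_cell_of_pos hx₀ hg (fun M => (hgu M).1) hgm hfm hZ' h) h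
      · exact both_neg (neg_on_cell_of_neg hx₀ hg (fun M => (hgu M).2) hgm hfm hZ' h) h
  · rcases dich f hf h1 with h | h
    · exact both_pos h (pos_on_cell_of_pos hx₀ hf (fun M => (hfu M).1) hfm hgm hZ h)
    · exact both_neg h (neg_on_cell_of_neg hx₀ hf (fun M => (hfu M).2) hfm hgm hZ h)

theorem SameCell.sign_eq {Z : Finset ℝ} {f : ℝ → ℝ} (hf : Continuous f)
    (h0 : ∀ x, f x = 0 → x ∈ Z) {x y : ℝ} (h : SameCell Z x y) :
    SignType.sign (f x) = SignType.sign (f y) := by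
  by_cases hx : x ∈ Z
  · rw [h.eq_of_mem hx]
  have hord : {u | SameCell Z x u}.OrdConnected :=
    ⟨fun a ha b hb u hu => ha.between hb hu.1 hu.2⟩
  have no_zero : ∀ u, SameCell Z x u → f u ≠ 0 := fun u hu hu0 =>
    hx (by have hZ := h0 u hu0; rwa [hu.symm.eq_of_mem hZ])
  have aux : ∀ a b, SameCell Z x a → SameCell Z x b → f a < 0 → 0 < f b → False := by
    intro a b ha hb hfa hfb
    obtain ⟨w, hw, hw0⟩ := hord.isPreconnected.intermediate_value ha hb hf.continuousOn
      (show (0 : ℝ) ∈ Icc (f a) (f b) from ⟨hfa.le, hfb.le⟩)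
    exact no_zero w hw hw0
  rcases lt_or_gt_of_ne (no_zero x (.refl _ _)) with h1 | h1 <;>
    rcases lt_or_gt_of_ne (no_zero y h) with h2 | h2
  · rw [sign_neg h1, sign_neg h2]
  · exact (aux x y (.refl _ _) h h1 h2).elim
  · exact (aux y x h (.refl _ _) h2 h1).elim
  · rw [sign_pos h1, sign_pos h2]

theorem eval_lt_eval_of_derivative_pos (P : Polynomial ℝ) {a b : ℝ} (hab : a < b)
    (h : ∀ x ∈ Ioo a b, 0 < P.derivative.eval x) : P.eval a < P.eval b := by
  have : StrictMonoOn (fun x => P.eval x) (Icc a b) := by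
    refine strictMonoOn_of_deriv_pos (convex_Icc a b) P.continuous.continuousOn ?_
    intro x hx
    rw [interior_Icc] at hx
    simpa using h x hx
  exact this (left_mem_Icc.2 hab.le) (right_mem_Icc.2 hab.le) hab

theorem exists_lt_abs_eval (P : Polynomial ℝ) (hP : 0 < P.degree) (x M : ℝ) :
    (∃ y < x, M < |P.eval y|) ∧ ∃ y > x, M < |P.eval y| := by
  constructor
  · exact ((eventually_lt_atBot x).and
      ((P.abs_tendsto_atBot hP).eventually_gt_atTop M)).exists
  · exact ((eventually_gt_atTop x).and
      ((P.abs_tendsto_atTop hP).eventually_gt_atTop M)).exists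

theorem exists_orderIso_of_derivative {P Q : Polynomial ℝ} (θ : ℝ ≃o ℝ) (Z : Finset ℝ)
    (hP : 0 < P.degree) (hQ : 0 < Q.degree)
    (hd : ∀ x, SignType.sign (P.derivative.eval x) = SignType.sign (Q.derivative.eval (θ x)))
    (hZ' : ∀ x, P.derivative.eval x = 0 → x ∈ Z)
    (hZ : ∀ z ∈ Z, SignType.sign (P.eval z) = SignType.sign (Q.eval (θ z))) :
    ∃ ψ : ℝ ≃o ℝ, (∀ z ∈ Z, ψ z = z) ∧
      ∀ x, SignType.sign (P.eval x) = SignType.sign (Q.eval (θ (ψ x))) := by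
  refine exists_orderIso_of_cells Z (fun x => P.eval x) (fun x => Q.eval (θ x)) fun x₀ => ?_
  by_cases hx₀ : x₀ ∈ Z
  · refine ⟨x₀, x₀, .refl _ _, .refl _ _, fun x y hx hy _ _ => ?_⟩
    rw [hx.eq_of_mem hx₀, hy.eq_of_mem hx₀]
    exact hZ x₀ hx₀
  have hcell : ∀ x, SameCell Z x₀ x →
      SignType.sign (P.derivative.eval x) = SignType.sign (P.derivative.eval x₀) :=
    fun x hx => (hx.sign_eq P.derivative.continuous hZ').symm
  have hθ : ∀ {a b : ℝ} {S : ℝ → Prop}, (∀ x ∈ Ioo a b, S x) →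
      ∀ y ∈ Ioo (θ a) (θ b), S (θ.symm y) := fun h y hy =>
    h _ ⟨by rw [θ.lt_symm_apply]; exact hy.1, by rw [θ.symm_apply_lt]; exact hy.2⟩
  have hPu := exists_lt_abs_eval P hP x₀
  have hQu : ∀ M, (∃ y < x₀, M < |Q.eval (θ y)|) ∧ ∃ y > x₀, M < |Q.eval (θ y)| := by
    intro M
    obtain ⟨⟨y, hy, hyM⟩, u, hu, huM⟩ := exists_lt_abs_eval Q hQ (θ x₀) M
    exact ⟨⟨θ.symm y, by rwa [θ.symm_apply_lt], by simpa using hyM⟩,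
      θ.symm u, by rw [gt_iff_lt, θ.lt_symm_apply]; exact hu, by simpa using huM⟩
  have hQc : Continuous fun x => Q.eval (θ x) := Q.continuous.comp θ.continuous
  have hne : P.derivative.eval x₀ ≠ 0 := fun h => hx₀ (hZ' _ h)
  rcases lt_or_gt_of_ne hne with hneg | hpos
  · have h1 : ∀ x, SameCell Z x₀ x → P.derivative.eval x < 0 := fun x hx => by
      rw [← sign_eq_neg_one_iff, hcell x hx, sign_neg hneg]
    have h2 : ∀ x, SameCell Z x₀ x → Q.derivative.eval (θ x) < 0 := fun x hx => by
      rw [← sign_eq_neg_one_iff, ← hd, sign_neg (h1 x hx)]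
    obtain ⟨w, w', hw, hw', H⟩ := exists_cell_matching_of_increasing (Z := Z)
      (f := fun x => -P.eval x) (g := fun x => -Q.eval (θ x)) (x₀ := x₀) hx₀
      P.continuous.neg hQc.neg
      (by simpa only [abs_neg] using hPu) (by simpa only [abs_neg] using hQu)
      (fun a b hab h => by
        have := eval_lt_eval_of_derivative_pos (-P) hab
          (fun x hx => by simpa using h1 x (h x hx))
        simpa using this)
      (fun a b hab h => by
        have := eval_lt_eval_of_derivative_pos (-Q) (θ.strictMono hab)
          (fun y hy => by simpa using h2 _ (hθ h y hy))
        simpa using this)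
      (fun z hz => by rw [Left.sign_neg, Left.sign_neg, hZ z hz])
    refine ⟨w, w', hw, hw', fun x y hx hy hl hr => ?_⟩
    have := H x y hx hy hl hr
    rwa [Left.sign_neg, Left.sign_neg, neg_inj] at this
  · have h1 : ∀ x, SameCell Z x₀ x → 0 < P.derivative.eval x := fun x hx => by
      rw [← sign_eq_one_iff, hcell x hx, sign_pos hpos]
    have h2 : ∀ x, SameCell Z x₀ x → 0 < Q.derivative.eval (θ x) := fun x hx => by
      rw [← sign_eq_one_iff, ← hd, sign_pos (h1 x hx)]
    exact exists_cell_matching_of_increasing hx₀ P.continuous hQc hPu hQu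
      (fun a b hab h => eval_lt_eval_of_derivative_pos P hab fun x hx => h1 x (h x hx))
      (fun a b hab h => eval_lt_eval_of_derivative_pos Q (θ.strictMono hab)
        fun y hy => by simpa using h2 _ (hθ h y hy)) hZ

theorem map_eraseLead_of_leadingCoeff_eq_zero {R S : Type*} [CommRing R] [CommRing S] (α : R →+* S)
    (p : Polynomial R) (h : α p.leadingCoeff = 0) : p.map α = p.eraseLead.map α := by
  conv_lhs => rw [← p.eraseLead_add_monomial_natDegree_leadingCoeff]
  rw [Polynomial.map_add, Polynomial.map_monomial, h, Polynomial.monomial_zero_right, add_zero]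

/-- Finitely many polynomial signs of the coefficients determine the sign diagram on the real line
of a finite family of univariate polynomials, up to an order automorphism of `ℝ`. -/
theorem exists_finset_forall_orderIso {R : Type*} [CommRing R] (L : Multiset (Polynomial R)) :
    ∃ F : Finset R, ∀ α β : R →+* ℝ,
      (∀ c ∈ F, SignType.sign (α c) = SignType.sign (β c)) →
      ∃ θ : ℝ ≃o ℝ, ∀ p ∈ L, ∀ x,
        SignType.sign ((p.map α).eval x) = SignType.sign ((p.map β).eval (θ x)) := by
  classical
  induction L using (InvImage.wf (fun L : Multiset (Polynomial R) => L.map Polynomial.natDegree)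
    Multiset.wellFounded_isDershowitzMannaLT).induction with
  | _ L ih =>
  by_cases hconst : ∀ p ∈ L, p.natDegree = 0
  · refine ⟨L.toFinset.image fun p => p.coeff 0, fun α β h => ⟨OrderIso.refl ℝ, ?_⟩⟩
    intro p hp x
    rw [Polynomial.eq_C_of_natDegree_eq_zero (hconst p hp)]
    simpa using h (p.coeff 0) (Finset.mem_image_of_mem _ (Multiset.mem_toFinset.2 hp))
  obtain ⟨P, hPL, hPmax⟩ : ∃ P ∈ L, ∀ q ∈ L, q.natDegree ≤ P.natDegree := by
    push Not at hconst
    obtain ⟨p, hp, _⟩ := hconst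
    obtain ⟨P, hP, h⟩ := L.toFinset.exists_max_image Polynomial.natDegree
      ⟨p, Multiset.mem_toFinset.2 hp⟩
    exact ⟨P, by simpa using hP, by simpa using h⟩
  have hPdeg : 0 < P.natDegree := by
    by_contra h0
    exact hconst fun p hp => by have := hPmax p hp; omega
  have hErase : ∀ p ∈ L, 0 < p.natDegree → ∃ F : Finset R, ∀ α β : R →+* ℝ,
      (∀ c ∈ F, SignType.sign (α c) = SignType.sign (β c)) →
      ∃ θ : ℝ ≃o ℝ, ∀ q ∈ p.eraseLead ::ₘ L.erase p, ∀ x,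
        SignType.sign ((q.map α).eval x) = SignType.sign ((q.map β).eval (θ x)) := by
    intro p hp hdeg
    apply ih
    refine ⟨(L.erase p).map Polynomial.natDegree, {p.eraseLead.natDegree}, {p.natDegree},
      by simp, by beta_reduce; rw [Multiset.map_cons, add_comm, Multiset.singleton_add], ?_, ?_⟩
    · conv_lhs => rw [← Multiset.cons_erase hp]
      beta_reduce; rw [Multiset.map_cons, add_comm, Multiset.singleton_add]
    · have := p.eraseLead_natDegree_le
      simp only [Multiset.mem_singleton, forall_eq, exists_eq_left]
      omega
  obtain ⟨L₀, rfl⟩ := Multiset.exists_cons_of_mem hPL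
  set G := Polynomial.derivative P ::ₘ L₀ with hG
  set rem₀ : Polynomial R :=
    Polynomial.C (P.natDegree : R) * P - Polynomial.X * Polynomial.derivative P with hrem₀
  set rem : Polynomial R → Polynomial R :=
    fun q => Polynomial.C q.leadingCoeff * q.cancelLeads P with hrem
  have hrem₀deg : rem₀.natDegree < P.natDegree := by
    have hle : rem₀.natDegree ≤ P.natDegree := by
      refine (Polynomial.natDegree_sub_le _ _).trans (max_le ?_ ?_)
      · exact Polynomial.natDegree_C_mul_le _ _
      · refine Polynomial.natDegree_mul_le.trans ?_
        have := Polynomial.natDegree_derivative_lt hPdeg.ne'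
        have := Polynomial.natDegree_X_le (R := R)
        omega
    have hcoeff : rem₀.coeff P.natDegree = 0 := by
      obtain ⟨d, hd⟩ := Nat.exists_eq_succ_of_ne_zero hPdeg.ne'
      rw [hrem₀, hd, Polynomial.coeff_sub, Polynomial.coeff_C_mul, Polynomial.coeff_X_mul,
        Polynomial.coeff_derivative]
      push_cast
      ring
    refine lt_of_le_of_ne hle fun heq => ?_
    rw [← heq, Polynomial.coeff_natDegree, Polynomial.leadingCoeff_eq_zero] at hcoeff
    rw [hcoeff] at heq
    simp at heq
    omega
  have hmain : ∃ F : Finset R, ∀ α β : R →+* ℝ,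
      (∀ c ∈ F, SignType.sign (α c) = SignType.sign (β c)) →
      ∃ θ : ℝ ≃o ℝ, ∀ q ∈ L₀ + (Polynomial.derivative P ::ₘ rem₀ ::ₘ L₀.map rem), ∀ x,
        SignType.sign ((q.map α).eval x) = SignType.sign ((q.map β).eval (θ x)) := by
    apply ih
    refine ⟨L₀.map Polynomial.natDegree,
      (Polynomial.derivative P ::ₘ rem₀ ::ₘ L₀.map rem).map Polynomial.natDegree,
      {P.natDegree}, by simp, by simp only [Multiset.map_add],
      by beta_reduce; rw [Multiset.map_cons, add_comm, Multiset.singleton_add], ?_⟩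
    intro y hy
    refine ⟨P.natDegree, by simp, ?_⟩
    obtain ⟨q, hq, rfl⟩ := Multiset.mem_map.1 hy
    rcases Multiset.mem_cons.1 hq with rfl | hq
    · exact Polynomial.natDegree_derivative_lt hPdeg.ne'
    rcases Multiset.mem_cons.1 hq with rfl | hq
    · exact hrem₀deg
    obtain ⟨q, hq', rfl⟩ := Multiset.mem_map.1 hq
    exact (Polynomial.natDegree_C_mul_le _ _).trans_lt
      (Polynomial.natDegree_cancelLeads_lt_of_natDegree_le_natDegree
        (hPmax q (Multiset.mem_cons_of_mem hq')) hPdeg)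
  choose! Fe hFe using hErase
  obtain ⟨Fm, hFm⟩ := hmain
  refine ⟨(P ::ₘ L₀).toFinset.image Polynomial.leadingCoeff ∪
    (P ::ₘ L₀).toFinset.biUnion Fe ∪ Fm, fun α β hαβ => ?_⟩
  have hlc : ∀ p ∈ P ::ₘ L₀,
      SignType.sign (α p.leadingCoeff) = SignType.sign (β p.leadingCoeff) := fun p hp =>
    hαβ _ (Finset.mem_union_left _ (Finset.mem_union_left _
      (Finset.mem_image_of_mem _ (Multiset.mem_toFinset.2 hp))))
  have hlc0 : ∀ p ∈ P ::ₘ L₀, α p.leadingCoeff = 0 ↔ β p.leadingCoeff = 0 := fun p hp => by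
    rw [← sign_eq_zero_iff, hlc p hp, sign_eq_zero_iff]
  by_cases hdrop : ∃ p ∈ P ::ₘ L₀, 0 < p.natDegree ∧ α p.leadingCoeff = 0
  · obtain ⟨p, hp, hpdeg, hp0⟩ := hdrop
    obtain ⟨θ, hθ⟩ := hFe p hp hpdeg α β fun c hc =>
      hαβ c (Finset.mem_union_left _ (Finset.mem_union_right _
        (Finset.mem_biUnion.2 ⟨p, Multiset.mem_toFinset.2 hp, hc⟩)))
    refine ⟨θ, fun q hq x => ?_⟩
    by_cases hqp : q = p
    · subst hqp
      rw [map_eraseLead_of_leadingCoeff_eq_zero α q hp0,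
        map_eraseLead_of_leadingCoeff_eq_zero β q ((hlc0 q hp).1 hp0)]
      exact hθ _ (Multiset.mem_cons_self _ _) x
    · exact hθ q (Multiset.mem_cons_of_mem ((Multiset.mem_erase_of_ne hqp).2 hq)) x
  push Not at hdrop
  obtain ⟨θ, hθ⟩ := hFm α β fun c hc => hαβ c (Finset.mem_union_right _ hc)
  have hdegree : ∀ γ : R →+* ℝ, γ P.leadingCoeff ≠ 0 → 0 < (P.map γ).degree := fun γ h => by
    rwa [← Polynomial.natDegree_pos_iff_degree_pos,
      Polynomial.natDegree_map_of_leadingCoeff_ne_zero γ h]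
  have hα := hdrop P (Multiset.mem_cons_self _ _) hPdeg
  have hβ := fun h => hα ((hlc0 P (Multiset.mem_cons_self _ _)).2 h)
  have hθG : ∀ q ∈ G, ∀ x,
      SignType.sign ((q.map α).eval x) = SignType.sign ((q.map β).eval (θ x)) := by
    intro q hq
    apply hθ q
    rcases Multiset.mem_cons.1 hq with rfl | hq
    · exact Multiset.mem_add.2 (Or.inr (Multiset.mem_cons_self _ _))
    · exact Multiset.mem_add.2 (Or.inl hq)
  set Z : Finset ℝ := G.toFinset.biUnion fun q => (q.map α).roots.toFinset with hZdef
  have mem_Z : ∀ q ∈ G, q.map α ≠ 0 → ∀ x, (q.map α).eval x = 0 → x ∈ Z := by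
    intro q hq hq0 x hx
    refine Finset.mem_biUnion.2 ⟨q, Multiset.mem_toFinset.2 hq, ?_⟩
    simpa [hq0] using hx
  have hder0 : (Polynomial.derivative P).map α ≠ 0 := by
    intro h0
    rw [← Polynomial.derivative_map] at h0
    have h1 := Polynomial.derivative_eq_zero.1 h0
    have := Polynomial.natDegree_pos_iff_degree_pos.2 (hdegree α hα)
    omega
  have hZ : ∀ z ∈ Z,
      SignType.sign ((P.map α).eval z) = SignType.sign ((P.map β).eval (θ z)) := by
    intro z hz
    obtain ⟨q, hq, hqz⟩ := Finset.mem_biUnion.1 hz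
    rw [Multiset.mem_toFinset] at hq hqz
    rw [Polynomial.mem_roots'] at hqz
    obtain ⟨hq0, hqz⟩ := hqz
    rw [Polynomial.IsRoot] at hqz
    have hqz' : (q.map β).eval (θ z) = 0 := by
      rw [← sign_eq_zero_iff, ← hθG q hq, hqz, sign_zero]
    rcases Multiset.mem_cons.1 hq with rfl | hq'
    · have h := hθ rem₀ (by simp) z
      have hpos : (0 : ℝ) < P.natDegree := by exact_mod_cast hPdeg
      simpa [hrem₀, hqz, hqz', sign_mul, sign_pos hpos] using h
    · have hqL : q ∈ P ::ₘ L₀ := Multiset.mem_cons_of_mem hq'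
      have hqdeg : 0 < q.natDegree := by
        by_contra h0
        have h0 : q.natDegree = 0 := by omega
        rw [Polynomial.eq_C_of_natDegree_eq_zero h0] at hqz hq0
        simp only [Polynomial.map_C, Polynomial.eval_C] at hqz
        simp [hqz] at hq0
      have hqα := hdrop q hqL hqdeg
      have hqβ : β q.leadingCoeff ≠ 0 := fun h => hqα ((hlc0 q hqL).2 h)
      have h := hθ (rem q) (by
        simp only [Multiset.mem_add, Multiset.mem_cons]
        exact Or.inr (Or.inr (Or.inr (Multiset.mem_map_of_mem _ hq')))) z
      have hsub : q.natDegree - P.natDegree = 0 := by have := hPmax q hqL; omega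
      have e : ∀ (γ : R →+* ℝ) (t : ℝ), (q.map γ).eval t = 0 →
          ((rem q).map γ).eval t = γ q.leadingCoeff ^ 2 * (P.map γ).eval t := by
        intro γ t ht
        simp only [hrem, Polynomial.cancelLeads, hsub, Polynomial.map_mul, Polynomial.map_sub,
          Polynomial.map_C, Polynomial.map_pow, Polynomial.map_X, Polynomial.eval_mul,
          Polynomial.eval_sub, Polynomial.eval_C, ht, pow_zero, Polynomial.map_one,
          Polynomial.eval_one]
        ring
      rw [e α z hqz, e β _ hqz', sign_mul, sign_mul,
        sign_pos (show 0 < α q.leadingCoeff ^ 2 by positivity),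
        sign_pos (show 0 < β q.leadingCoeff ^ 2 by positivity)] at h
      simpa using h
  obtain ⟨ψ, hψZ, hψ⟩ := exists_orderIso_of_derivative (P := P.map α) (Q := P.map β) θ Z
    (hdegree α hα) (hdegree β hβ)
    (fun x => by
      simpa only [Polynomial.derivative_map] using hθG _ (Multiset.mem_cons_self _ _) x)
    (fun x hx => mem_Z _ (Multiset.mem_cons_self _ _) hder0 x
      (by simpa only [Polynomial.derivative_map] using hx)) hZ
  refine ⟨ψ.trans θ, fun p hp x => ?_⟩
  rcases Multiset.mem_cons.1 hp with rfl | hp'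
  · exact hψ x
  have hpG : p ∈ G := Multiset.mem_cons_of_mem hp'
  have hcell : SameCell Z x (ψ x) := by
    intro z hz
    conv_lhs => rw [← ψ.lt_iff_lt, hψZ z hz]
    refine ⟨Iff.rfl, ?_⟩
    conv_lhs => rw [← ψ.lt_iff_lt, hψZ z hz]
  rw [OrderIso.trans_apply, ← hθG p hpG]
  by_cases hp0 : p.map α = 0
  · simp [hp0]
  · exact hcell.sign_eq (p.map α).continuous (mem_Z p hpG hp0)

/-- A predicate on `ℝ^ι` whose truth value depends only on the signs of finitely many
polynomials. -/
def SignDetermined {ι : Type} (p : (ι → ℝ) → Prop) : Prop :=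
  ∃ F : Finset (MvPolynomial ι ℝ), ∀ a b : ι → ℝ,
    (∀ c ∈ F, SignType.sign (eval a c) = SignType.sign (eval b c)) → p a → p b

/-- A real-valued function on `ℝ^ι` given by a polynomial. -/
def IsPolyFun {ι : Type} (q : (ι → ℝ) → ℝ) : Prop :=
  ∃ p : MvPolynomial ι ℝ, ∀ b, q b = eval b p

theorem SignDetermined.isSemialgebraic {ι : Type} {S : Set (ι → ℝ)}
    (h : SignDetermined fun a => a ∈ S) : IsSemialgebraic S := by
  classical
  obtain ⟨F, hF⟩ := h
  let T := {σ : F → SignType // ∃ a ∈ S, ∀ c : F, SignType.sign (eval a c.1) = σ c}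
  have : Finite T := Subtype.finite
  obtain ⟨q, ⟨e⟩⟩ := Finite.exists_equiv_fin T
  let E : T → Finset (MvPolynomial ι ℝ) := fun σ =>
    (Finset.univ.filter fun c : F => σ.1 c = 0).image Subtype.val
  let P : T → Finset (MvPolynomial ι ℝ) := fun σ =>
    (Finset.univ.filter fun c : F => σ.1 c = 1).image Subtype.val ∪
      (Finset.univ.filter fun c : F => σ.1 c = -1).image fun c => -c.1
  refine ⟨q, fun i => E (e.symm i), fun i => P (e.symm i), ?_⟩
  ext z
  rw [mem_iUnion]
  constructor
  · intro hz
    refine ⟨e ⟨fun c => SignType.sign (eval z c.1), z, hz, fun c => rfl⟩, ?_⟩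
    simp only [Equiv.symm_apply_apply, E, P, mem_ofPred_eq, Finset.mem_image, Finset.mem_filter,
      Finset.mem_univ, true_and, Finset.mem_union]
    constructor
    · rintro p ⟨c, hc, rfl⟩
      exact sign_eq_zero_iff.1 hc
    · rintro p (⟨c, hc, rfl⟩ | ⟨c, hc, rfl⟩)
      · exact sign_eq_one_iff.1 hc
      · simpa using sign_eq_neg_one_iff.1 hc
  · rintro ⟨i, hE, hP⟩
    obtain ⟨a, ha, hσ⟩ := (e.symm i).2
    refine hF a z (fun c hc => ?_) ha
    have h1 := hσ ⟨c, hc⟩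
    simp only at h1
    rw [h1]
    symm
    rcases hs : (e.symm i).1 ⟨c, hc⟩ with _ | _ | _
    · exact sign_eq_zero_iff.2 (hE c (Finset.mem_image.2 ⟨⟨c, hc⟩, by simpa using hs, rfl⟩))
    · have := hP (-c) (Finset.mem_union_right _
        (Finset.mem_image.2 ⟨⟨c, hc⟩, by simpa using hs, rfl⟩))
      exact sign_eq_neg_one_iff.2 (by simpa using this)
    · exact sign_eq_one_iff.2 (hP c (Finset.mem_union_left _
        (Finset.mem_image.2 ⟨⟨c, hc⟩, by simpa using hs, rfl⟩)))

theorem IsSemialgebraic.signDetermined {ι : Type} {S : Set (ι → ℝ)} (h : IsSemialgebraic S) :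
    SignDetermined fun a => a ∈ S := by
  classical
  obtain ⟨q, E, P, rfl⟩ := h
  refine ⟨Finset.univ.biUnion fun i => E i ∪ P i, fun a b hab ha => ?_⟩
  obtain ⟨i, hE, hP⟩ := mem_iUnion.1 ha
  have hmem : ∀ c ∈ E i ∪ P i, SignType.sign (eval a c) = SignType.sign (eval b c) :=
    fun c hc => hab c (Finset.mem_biUnion.2 ⟨i, Finset.mem_univ _, hc⟩)
  refine mem_iUnion.2 ⟨i, fun p hp => ?_, fun p hp => ?_⟩
  · rw [← sign_eq_zero_iff, ← hmem p (Finset.mem_union_left _ hp), hE p hp, sign_zero]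
  · rw [← sign_eq_one_iff, ← hmem p (Finset.mem_union_right _ hp), sign_pos (hP p hp)]

namespace IsPolyFun

variable {ι κ : Type}

theorem coord (i : ι) : IsPolyFun fun b : ι → ℝ => b i := ⟨X i, by simp⟩

theorem const (c : ℝ) : IsPolyFun fun _ : ι → ℝ => c := ⟨C c, by simp⟩

theorem sub {f g : (ι → ℝ) → ℝ} (hf : IsPolyFun f) (hg : IsPolyFun g) :
    IsPolyFun fun b => f b - g b := by
  obtain ⟨p, hp⟩ := hf
  obtain ⟨q, hq⟩ := hg
  exact ⟨p - q, by simp [hp, hq]⟩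

theorem neg {f : (ι → ℝ) → ℝ} (hf : IsPolyFun f) : IsPolyFun fun b => -f b := by
  obtain ⟨p, hp⟩ := hf
  exact ⟨-p, by simp [hp]⟩

theorem eval_comp (f : MvPolynomial ι ℝ) {g : (κ → ℝ) → ι → ℝ}
    (hg : ∀ i, IsPolyFun fun b => g b i) : IsPolyFun fun b => eval (g b) f := by
  choose p hp using hg
  refine ⟨aeval p f, fun b => ?_⟩
  have : g b = fun i => eval b (p i) := funext fun i => hp i b
  change eval (g b) f = _
  rw [this]
  induction f using MvPolynomial.induction_on with
  | C a => simp [MvPolynomial.algebraMap_eq]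
  | add p q hp hq => simp [hp, hq]
  | mul_X p i hp => simp [hp]

end IsPolyFun

namespace SignDetermined

variable {ι κ : Type} {p q : (ι → ℝ) → Prop}

theorem not (hp : SignDetermined p) : SignDetermined fun a => ¬ p a := by
  obtain ⟨F, hF⟩ := hp
  exact ⟨F, fun a b hab ha hb => ha (hF b a (fun c hc => (hab c hc).symm) hb)⟩

theorem and (hp : SignDetermined p) (hq : SignDetermined q) :
    SignDetermined fun a => p a ∧ q a := by
  classical
  obtain ⟨F, hF⟩ := hp
  obtain ⟨G, hG⟩ := hq
  exact ⟨F ∪ G, fun a b hab h =>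
    ⟨hF a b (fun c hc => hab c (Finset.mem_union_left _ hc)) h.1,
      hG a b (fun c hc => hab c (Finset.mem_union_right _ hc)) h.2⟩⟩

theorem congr (hp : SignDetermined p) (h : ∀ a, p a ↔ q a) : SignDetermined q := by
  have : p = q := funext fun a => propext (h a)
  exact this ▸ hp

theorem imp (hp : SignDetermined p) (hq : SignDetermined q) :
    SignDetermined fun a => p a → q a :=
  ((hp.and hq.not).not).congr fun a => by tauto

theorem forall_finite {α : Type} [Finite α] {p : α → (ι → ℝ) → Prop}
    (hp : ∀ i, SignDetermined (p i)) : SignDetermined fun a => ∀ i, p i a := by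
  classical
  have := Fintype.ofFinite α
  choose F hF using hp
  exact ⟨Finset.univ.biUnion F, fun a b hab h i => hF i a b
    (fun c hc => hab c (Finset.mem_biUnion.2 ⟨i, Finset.mem_univ _, hc⟩)) (h i)⟩

theorem lt {f g : (ι → ℝ) → ℝ} (hf : IsPolyFun f) (hg : IsPolyFun g) :
    SignDetermined fun a => f a < g a := by
  obtain ⟨r, hr⟩ := hg.sub hf
  refine ⟨{r}, fun a b hab h => ?_⟩
  have h1 := hab r (Finset.mem_singleton_self _)
  rw [← hr, ← hr, sign_pos (sub_pos.2 h)] at h1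
  exact sub_pos.1 (sign_eq_one_iff.1 h1.symm)

theorem le {f g : (ι → ℝ) → ℝ} (hf : IsPolyFun f) (hg : IsPolyFun g) :
    SignDetermined fun a => f a ≤ g a :=
  (lt hg hf).not.congr fun _ => not_lt

theorem comp (hp : SignDetermined p) {g : (κ → ℝ) → ι → ℝ}
    (hg : ∀ i, IsPolyFun fun b => g b i) : SignDetermined fun b => p (g b) := by
  classical
  obtain ⟨F, hF⟩ := hp
  choose r hr using fun f : MvPolynomial ι ℝ => IsPolyFun.eval_comp f hg
  refine ⟨F.image r, fun a b hab h => hF _ _ (fun c hc => ?_) h⟩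
  have hr' : ∀ f b, eval (g b) f = eval b (r f) := hr
  rw [hr', hr']
  exact hab _ (Finset.mem_image_of_mem _ hc)

theorem exists_real {p : (ι → ℝ) → ℝ → Prop}
    (hp : SignDetermined fun w : Option ι → ℝ => p (fun i => w (some i)) (w none)) :
    SignDetermined fun a => ∃ t, p a t := by
  obtain ⟨F, hF⟩ := hp
  obtain ⟨G, hG⟩ := exists_finset_forall_orderIso (F.val.map (optionEquivLeft ℝ ι))
  refine ⟨G, fun a b hab => ?_⟩
  rintro ⟨t, ht⟩
  obtain ⟨θ, hθ⟩ := hG (eval a) (eval b) hab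
  refine ⟨θ t, hF (fun o => Option.elim o t a) (fun o => Option.elim o (θ t) b) (fun c hc => ?_) ht⟩
  rw [optionEquivLeft_elim_eval, optionEquivLeft_elim_eval]
  exact hθ _ (Multiset.mem_map_of_mem _ hc) t

theorem forall_real {p : (ι → ℝ) → ℝ → Prop}
    (hp : SignDetermined fun w : Option ι → ℝ => p (fun i => w (some i)) (w none)) :
    SignDetermined fun a => ∀ t, p a t :=
  (exists_real (p := fun a t => ¬ p a t) hp.not).not.congr fun a => by simp

theorem exists_vec [Finite κ] {p : (ι → ℝ) → (κ → ℝ) → Prop}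
    (hp : SignDetermined fun w : ι ⊕ κ → ℝ => p (fun i => w (Sum.inl i)) fun k => w (Sum.inr k)) :
    SignDetermined fun a => ∃ y, p a y := by
  induction κ using Finite.induction_empty_option generalizing ι with
  | @of_equiv α β e ih =>
    refine (ih (p := fun a y => p a fun k => y (e.symm k)) ?_).congr fun a => ?_
    · exact hp.comp (g := fun w => Sum.elim (fun i => w (Sum.inl i))
        fun k => w (Sum.inr (e.symm k))) (by rintro (i | i) <;> exact .coord _)
    · exact ⟨fun ⟨y, hy⟩ => ⟨_, hy⟩, fun ⟨y, hy⟩ => ⟨fun k => y (e k), by simpa using hy⟩⟩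
  | h_empty =>
    refine (hp.comp (κ := ι) (g := fun w => Sum.elim w PEmpty.elim)
      (by rintro (i | i); exacts [.coord _, i.elim])).congr fun a => ?_
    exact ⟨fun h => ⟨_, h⟩, fun ⟨y, hy⟩ => by
      rw [Subsingleton.elim y fun k => Sum.elim a PEmpty.elim (Sum.inr k)] at hy
      exact hy⟩
  | @h_option α _ ih =>
    refine (exists_real (p := fun a t => ∃ y : α → ℝ, p a fun o => o.elim t y)
      (ih (p := fun w y => p (fun i => w (some i)) fun o => o.elim (w none) y) ?_)).congr
        fun a => ?_
    · exact hp.comp (g := fun w => Sum.elim (fun i => w (Sum.inl (some i)))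
        fun o => o.elim (w (Sum.inl none)) fun k => w (Sum.inr k))
        (by rintro (i | _ | i) <;> exact .coord _)
    · constructor
      · rintro ⟨t, y, h⟩
        exact ⟨_, h⟩
      · rintro ⟨y, h⟩
        refine ⟨y none, fun k => y (some k), ?_⟩
        convert h using 2 with o
        cases o <;> rfl

theorem forall_vec [Finite κ] {p : (ι → ℝ) → (κ → ℝ) → Prop}
    (hp : SignDetermined fun w : ι ⊕ κ → ℝ => p (fun i => w (Sum.inl i)) fun k => w (Sum.inr k)) :
    SignDetermined fun a => ∀ y, p a y :=
  (exists_vec (p := fun a y => ¬ p a y) hp.not).not.congr fun a => by simp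

end SignDetermined

theorem IsCompact.isGLB_sInf_eval {ι : Type} {Ω S : Set (ι → ℝ)} (hΩ : IsCompact Ω) (hS : S ⊆ Ω)
    (hne : S.Nonempty) (f : MvPolynomial ι ℝ) :
    IsGLB ((fun z => eval z f) '' S) (sInf ((fun z => eval z f) '' S)) :=
  isGLB_csInf (hne.image _)
    ((hΩ.image (MvPolynomial.continuous_eval f)).bddBelow.mono (image_mono hS))

namespace SignDetermined

/-- The lower bounds of a polynomial on a family of fibres form a predicate determined by
signs. -/
theorem forall_imp_le_eval {ι κ : Type} [Finite κ] {p : ℝ → (κ → ℝ) → Prop} {t : (ι → ℝ) → ℝ}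
    {e : (ι → ℝ) → ℝ} (ht : IsPolyFun t) (he : IsPolyFun e) (f : MvPolynomial κ ℝ)
    (hp : SignDetermined fun w : Option κ → ℝ => p (w none) fun k => w (some k)) :
    SignDetermined fun a => ∀ z, p (e a) z → t a ≤ eval z f := by
  have hl {q : (ι → ℝ) → ℝ} (hq : IsPolyFun q) :
      IsPolyFun fun w : ι ⊕ κ → ℝ => q fun i => w (Sum.inl i) := by
    obtain ⟨r, hr⟩ := hq
    simp only [hr]
    exact IsPolyFun.eval_comp r fun i => .coord _
  refine forall_vec (imp (hp.comp (g := fun w o =>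
    o.elim (e fun i => w (Sum.inl i)) fun k => w (Sum.inr k)) ?_)
    (le (hl ht) (IsPolyFun.eval_comp f fun i => .coord _)))
  rintro (_ | k)
  · exact hl he
  · exact .coord _

/-- The graph over `[0, ∞)` of the infimum of a polynomial over a family of sets determined by
signs is determined by signs. -/
theorem graph_of_isGLB {κ : Type} [Finite κ] {p : ℝ → (κ → ℝ) → Prop} {v : ℝ → ℝ}
    (f : MvPolynomial κ ℝ)
    (hp : SignDetermined fun w : Option κ → ℝ => p (w none) fun k => w (some k))
    (hv : ∀ ε, 0 ≤ ε → IsGLB ((fun z => eval z f) '' {z | p ε z}) (v ε)) :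
    SignDetermined fun w : Fin 2 → ℝ => 0 ≤ w 0 ∧ w 1 = v (w 0) := by
  refine ((le (.const 0) (.coord 0)).and ((forall_imp_le_eval (.coord 1) (.coord 0) f hp).and
    (forall_real (p := fun w t => (∀ z, p (w 0) z → t ≤ eval z f) → t ≤ w 1)
      (imp (forall_imp_le_eval (.coord none) (.coord (some 0)) f hp)
        (le (.coord none) (.coord (some 1))))))).congr fun w => and_congr_right fun h0 => ?_
  have : IsGLB ((fun z => eval z f) '' {z | p (w 0) z}) (w 1) ↔ w 1 = v (w 0) :=
    ⟨fun h => h.unique (hv _ h0), fun h => h ▸ hv _ h0⟩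
  rw [← this]
  simp [IsGLB, IsGreatest, mem_upperBounds, mem_lowerBounds]

end SignDetermined

/-- A predicate determined by signs is open away from the zeros of nonzero polynomials. -/
theorem SignDetermined.exists_eventually {ι : Type} [Finite ι] {p : (ι → ℝ) → Prop}
    (hp : SignDetermined p) :
    ∃ P : MvPolynomial ι ℝ, P ≠ 0 ∧ ∀ a, eval a P ≠ 0 → p a → ∀ᶠ b in 𝓝 a, p b := by
  classical
  obtain ⟨F, hF⟩ := hp
  refine ⟨∏ c ∈ F.erase 0, c, Finset.prod_ne_zero_iff.2 fun c hc => Finset.ne_of_mem_erase hc,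
    fun a ha hpa => ?_⟩
  rw [map_prod, Finset.prod_ne_zero_iff] at ha
  have h : ∀ c ∈ F, ∀ᶠ b in 𝓝 a, SignType.sign (eval a c) = SignType.sign (eval b c) := by
    intro c hc
    rcases eq_or_ne c 0 with rfl | h0
    · simp
    have hca := (MvPolynomial.continuous_eval c).continuousAt (x := a)
    rcases (ha c (Finset.mem_erase.2 ⟨h0, hc⟩)).lt_or_gt with h | h
    · filter_upwards [hca.eventually (gt_mem_nhds h)] with b hb
      rw [sign_neg h, sign_neg hb]
    · filter_upwards [hca.eventually (lt_mem_nhds h)] with b hb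
      rw [sign_pos h, sign_pos hb]
  filter_upwards [(eventually_all_finset F).2 h] with b hb
  exact hF a b hb hpa

theorem Set.Countable.finite_of_signDetermined {S : Set ℝ} (hS : S.Countable)
    (h : SignDetermined fun w : Fin 1 → ℝ => w 0 ∈ S) : S.Finite := by
  obtain ⟨P, hP0, hP⟩ := h.exists_eventually
  let p : Polynomial ℝ := aeval (fun _ => Polynomial.X) P
  have hp (a : Fin 1 → ℝ) : p.eval (a 0) = eval a P := by
    have : (Polynomial.aeval (a 0)).comp (aeval fun _ => Polynomial.X) =
        (aeval a : MvPolynomial (Fin 1) ℝ →ₐ[ℝ] ℝ) :=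
      MvPolynomial.algHom_ext fun i => by simp [Subsingleton.elim i 0]
    simpa using DFunLike.congr_fun this P
  have hp0 : p ≠ 0 := fun h0 => hP0 (MvPolynomial.funext fun a => by rw [← hp, h0]; simp)
  refine (Polynomial.finite_setOfPred_isRoot hp0).subset fun x hx => ?_
  by_contra hne
  have hev := hP (fun _ => x) (by rw [← hp]; exact hne) hx
  have hc : Continuous fun (y : ℝ) (_ : Fin 1) => y := by fun_prop
  obtain ⟨y, hy, hyS⟩ := (hS.dense_compl ℝ).inter_nhds_nonempty (hc.continuousAt.eventually hev)
  exact hy hyS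

/-- The discontinuities of a function whose graph is determined by signs form a set determined
by signs. -/
theorem SignDetermined.not_continuousAt {v : ℝ → ℝ}
    (hv : SignDetermined fun w : Fin 2 → ℝ => 0 ≤ w 0 ∧ w 1 = v (w 0)) :
    SignDetermined fun w : Fin 1 → ℝ => w 0 ∈ {ε | 0 < ε ∧ ¬ ContinuousAt v ε} := by
  let G (ε t : ℝ) : Prop := 0 ≤ ε ∧ t = v ε
  have hG {ι : Type} (i j : ι) : SignDetermined fun w : ι → ℝ => G (w i) (w j) :=
    hv.comp (g := fun w => ![w i, w j]) fun k => by fin_cases k <;> exact .coord _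
  have hd {ι : Type} (i j k : ι) : SignDetermined fun w : ι → ℝ => w i - w j < w k :=
    lt ((IsPolyFun.coord i).sub (.coord j)) (.coord k)
  have h1 : SignDetermined fun w : Option (Option (Fin 1)) → ℝ => ∀ y : Fin 3 → ℝ,
      G (w (some (some 0))) (y 1) → G (y 0) (y 2) → y 0 - w (some (some 0)) < w none →
        w (some (some 0)) - y 0 < w none →
          y 2 - y 1 < w (some none) ∧ y 1 - y 2 < w (some none) :=
    forall_vec (imp (hG _ _) (imp (hG _ _) (imp (hd _ _ _) (imp (hd _ _ _)
      ((hd _ _ _).and (hd _ _ _))))))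
  have h2 : SignDetermined fun w : Option (Fin 1) → ℝ => 0 < w none → ∃ η, 0 < η ∧
      ∀ y : Fin 3 → ℝ, G (w (some 0)) (y 1) → G (y 0) (y 2) → y 0 - w (some 0) < η →
        w (some 0) - y 0 < η → y 2 - y 1 < w none ∧ y 1 - y 2 < w none :=
    imp (lt (.const 0) (.coord none)) (exists_real
      (p := fun w η => 0 < η ∧ ∀ y : Fin 3 → ℝ, G (w (some 0)) (y 1) → G (y 0) (y 2) →
        y 0 - w (some 0) < η → w (some 0) - y 0 < η → y 2 - y 1 < w none ∧ y 1 - y 2 < w none)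
      ((lt (.const 0) (.coord none)).and h1))
  refine ((lt (.const 0) (.coord 0)).and (forall_real (p := fun w δ => 0 < δ → ∃ η, 0 < η ∧
    ∀ y : Fin 3 → ℝ, G (w 0) (y 1) → G (y 0) (y 2) → y 0 - w 0 < η → w 0 - y 0 < η →
      y 2 - y 1 < δ ∧ y 1 - y 2 < δ) h2).not).congr fun w => ?_
  refine and_congr_right fun h0 => not_congr ?_
  rw [Metric.continuousAt_iff]
  refine forall_congr' fun δ => imp_congr_right fun hδ => ?_
  constructor
  · rintro ⟨η, hη, h⟩
    refine ⟨min η (w 0), lt_min hη h0, fun {x} hx => ?_⟩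
    rw [Real.dist_eq, lt_min_iff, abs_lt, abs_lt] at hx
    have := h ![x, v (w 0), v x] ⟨h0.le, rfl⟩
      ⟨by change 0 ≤ x; linarith [hx.2.1], rfl⟩ hx.1.2 (by change w 0 - x < η; linarith [hx.1.1])
    change v x - v (w 0) < δ ∧ v (w 0) - v x < δ at this
    rw [Real.dist_eq, abs_lt]
    constructor <;> linarith
  · rintro ⟨η, hη, h⟩
    refine ⟨η, hη, fun y h1 h2 h3 h4 => ?_⟩
    have := @h (y 0) (by rw [Real.dist_eq, abs_lt]; constructor <;> linarith)
    rw [Real.dist_eq, abs_lt] at this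
    rw [h1.2, h2.2]
    constructor <;> linarith

theorem Polynomial.exists_map_fractionRing_eq_C_mul {A : Type*} [CommRing A] [IsDomain A]
    (p : Polynomial (FractionRing A)) : ∃ d : A, d ≠ 0 ∧ ∃ q : Polynomial A,
      q.map (algebraMap A (FractionRing A)) = Polynomial.C (algebraMap A _ d) * p := by
  obtain ⟨d, hd, h⟩ := IsLocalization.integerNormalization_spec (nonZeroDivisors A) p
  refine ⟨d, nonZeroDivisors.ne_zero hd, _, h.trans ?_⟩
  ext i
  simp [Algebra.smul_def]

/-- Away from finitely many fibres the zeros of a bivariate polynomial are simple zeros of its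
squarefree part. -/
theorem Polynomial.exists_evalEval_derivative_ne_zero {k : Type*} [Field k] [CharZero k]
    (Q : k[X][Y]) (hQ : Q ≠ 0) : ∃ (e : Polynomial k) (r : k[X][Y]), e ≠ 0 ∧
      ∀ x y, e.eval x ≠ 0 → Q.evalEval x y = 0 →
        r.evalEval x y = 0 ∧ (Polynomial.derivative r).evalEval x y ≠ 0 := by
  classical
  let K := FractionRing (Polynomial k)
  let ι := algebraMap (Polynomial k) K
  have hι : Function.Injective ι := IsFractionRing.injective _ _
  have : CharZero K := charZero_of_injective_algebraMap hι
  have hmap := Polynomial.map_injective ι hι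
  let Q' : Polynomial K := Q.map ι
  have hQ' : Q' ≠ 0 := fun h => hQ (hmap (by simpa [Q'] using h))
  let ρ := UniqueFactorizationMonoid.radical Q'
  have hsep : ρ.Separable :=
    PerfectField.separable_iff_squarefree.2 UniqueFactorizationMonoid.squarefree_radical
  obtain ⟨a, b, hab⟩ := hsep
  obtain ⟨N, c, hc⟩ := UniqueFactorizationMonoid.exists_dvd_radical_self_pow hQ'
  obtain ⟨d, hd, r, hr⟩ := Polynomial.exists_map_fractionRing_eq_C_mul ρ
  obtain ⟨da, hda, a', ha'⟩ := Polynomial.exists_map_fractionRing_eq_C_mul a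
  obtain ⟨db, hdb, b', hb'⟩ := Polynomial.exists_map_fractionRing_eq_C_mul b
  obtain ⟨dc, hdc, c', hc'⟩ := Polynomial.exists_map_fractionRing_eq_C_mul c
  have h1 : C db * a' * r + C da * b' * derivative r = C (da * db * d) := by
    apply hmap
    simp only [Polynomial.map_add, Polynomial.map_mul, Polynomial.map_C, ← derivative_map]
    rw [hr, ha', hb', derivative_C_mul]
    simp only [map_mul]
    linear_combination C (ι da) * C (ι db) * C (ι d) * hab
  have h2 : C (d ^ N) * Q * c' = C dc * r ^ N := by
    apply hmap
    simp only [Polynomial.map_mul, Polynomial.map_C, Polynomial.map_pow]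
    change _ * Q' * c'.map ι = _ * r.map ι ^ N
    rw [hr, hc', mul_pow]
    simp only [map_pow]
    linear_combination -(C (ι d) ^ N * C (ι dc)) * hc
  refine ⟨da * db * d * dc, r, by simp [*], fun x y he hQxy => ?_⟩
  have h1' := congrArg (evalEval x y) h1
  have h2' := congrArg (evalEval x y) h2
  simp only [evalEval_add, evalEval_mul, evalEval_C, evalEval_pow, hQxy] at h1' h2'
  simp only [Polynomial.eval_mul, mul_ne_zero_iff] at he
  have hr0 : r.evalEval x y = 0 := by
    have : dc.eval x * r.evalEval x y ^ N = 0 := by rw [← h2']; ring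
    exact eq_zero_of_pow_eq_zero ((mul_eq_zero.1 this).resolve_left he.2)
  refine ⟨hr0, fun h => ?_⟩
  rw [hr0, h] at h1'
  simp [he] at h1'

theorem Polynomial.contDiff_evalEval {n : WithTop ℕ∞} (r : ℝ[X][Y]) :
    ContDiff ℝ n fun u : ℝ × ℝ => r.evalEval u.1 u.2 := by
  induction r using Polynomial.induction_on' with
  | add p q hp hq => simpa only [evalEval_add] using hp.add hq
  | monomial k c =>
    have : (fun u : ℝ × ℝ => (Polynomial.monomial k c).evalEval u.1 u.2) =
        fun u => Polynomial.aeval u.1 c * u.2 ^ k := by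
      ext u
      simp [Polynomial.evalEval]
    rw [this]
    exact ((Polynomial.contDiff_aeval c n).comp contDiff_fst).mul (contDiff_snd.pow k)

theorem Polynomial.hasDerivAt_evalEval (r : ℝ[X][Y]) (x y : ℝ) :
    HasDerivAt (fun t => r.evalEval x t) ((Polynomial.derivative r).evalEval x y) y := by
  have h (q : ℝ[X][Y]) (t : ℝ) : q.evalEval x t = (q.map (Polynomial.evalRingHom x)).eval t := by
    induction q using Polynomial.induction_on' with
    | add p q hp hq => simp [hp, hq]
    | monomial k c => simp [Polynomial.evalEval]
  simp only [h, ← Polynomial.derivative_map]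
  exact Polynomial.hasDerivAt _ _

/-- A continuous function which is a simple zero of a bivariate polynomial is analytic. -/
theorem analyticAt_of_evalEval_eq_zero {r : ℝ[X][Y]} {v : ℝ → ℝ} {x : ℝ}
    (hv : ContinuousAt v x) (hr : ∀ᶠ z in 𝓝 x, r.evalEval z (v z) = 0)
    (hr' : (Polynomial.derivative r).evalEval x (v x) ≠ 0) : AnalyticAt ℝ v x := by
  let f := fun u : ℝ × ℝ => r.evalEval u.1 u.2
  have hf : ContDiffAt ℝ ⊤ f (x, v x) := (Polynomial.contDiff_evalEval r).contDiffAt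
  have hn : (⊤ : WithTop ℕ∞) ≠ 0 := by simp
  have hinv : (fderiv ℝ f (x, v x) ∘L .inr ℝ ℝ ℝ).IsInvertible := by
    refine ⟨ContinuousLinearEquiv.unitsEquivAut ℝ (Units.mk0 _ hr'), ?_⟩
    ext
    have h1 := (hf.differentiableAt hn).hasFDerivAt.comp (v x)
      (hasFDerivAt_prodMk_right x (v x))
    have h2 := h1.hasDerivAt.unique (Polynomial.hasDerivAt_evalEval r x (v x))
    simpa using h2.symm
  have han := hf.contDiffAt_implicitFunction hn hinv
  have huniq := hf.eventually_apply_eq_iff_implicitFunction hn hinv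
  refine (han.analyticAt).congr ?_
  have hc : ContinuousAt (fun z => (z, v z)) x := continuousAt_id.prodMk hv
  filter_upwards [hc.eventually huniq, hr] with z hz h0
  exact hz.1 (h0.trans hr.self_of_nhds.symm)

/-- A function on `[0, ∞)` which is antitone with graph determined by signs is analytic off a
finite set. -/
theorem SignDetermined.exists_finite_analyticAt {v : ℝ → ℝ}
    (hv : SignDetermined fun w : Fin 2 → ℝ => 0 ≤ w 0 ∧ w 1 = v (w 0))
    (hanti : AntitoneOn v (Ici 0)) :
    ∃ T : Set ℝ, T.Finite ∧ ∀ ε : ℝ, 0 ≤ ε → ε ∉ T → AnalyticAt ℝ v ε := by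
  have hdisc : {ε | 0 < ε ∧ ¬ ContinuousAt v ε}.Finite := by
    refine Set.Countable.finite_of_signDetermined ?_ hv.not_continuousAt
    have hu : Antitone fun ε => v (max 0 ε) := fun a b hab =>
      hanti (mem_Ici.2 (le_max_left _ _)) (mem_Ici.2 (le_max_left _ _)) (max_le_max_left 0 hab)
    refine hu.countable_not_continuousAt.mono ?_
    rintro ε hε (hc : ContinuousAt _ ε)
    refine hε.2 (hc.congr ?_)
    filter_upwards [lt_mem_nhds hε.1] with y hy
    rw [max_eq_right hy.le]
  obtain ⟨P, hP0, hP⟩ := hv.exists_eventually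
  have hPv : ∀ ε, 0 ≤ ε → eval ![ε, v ε] P = 0 := by
    intro ε hε
    by_contra hne
    have hc : Continuous fun t : ℝ => ![ε, t] := by fun_prop
    have hev : ∀ᶠ t in 𝓝 (v ε), t = v ε :=
      (hc.continuousAt.eventually (hP _ hne ⟨hε, rfl⟩)).mono fun t ht => ht.2
    obtain ⟨t, ht, ht'⟩ := ((hev.filter_mono nhdsWithin_le_nhds).and
      (self_mem_nhdsWithin (s := {v ε}ᶜ))).exists
    exact ht' ht
  let Q : ℝ[X][Y] := aeval ![Polynomial.C Polynomial.X, Polynomial.X] P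
  have hQ (x y : ℝ) : Q.evalEval x y = eval ![x, y] P := by
    have : ((Polynomial.evalEvalRingHom x y).comp
        (aeval ![Polynomial.C Polynomial.X, Polynomial.X] :
          MvPolynomial (Fin 2) ℝ →ₐ[ℝ] ℝ[X][Y]).toRingHom) = eval ![x, y] := by
      apply MvPolynomial.ringHom_ext
      · intro c
        simp
      · intro i
        fin_cases i <;> simp
    exact DFunLike.congr_fun this P
  have hQ0 : Q ≠ 0 := fun h0 => hP0 (MvPolynomial.funext fun a => by
    rw [show a = ![a 0, a 1] by ext i; fin_cases i <;> rfl, ← hQ, h0]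
    simp)
  obtain ⟨e, r, he, hr⟩ := Polynomial.exists_evalEval_derivative_ne_zero Q hQ0
  refine ⟨({0} ∪ {ε | 0 < ε ∧ ¬ ContinuousAt v ε}) ∪ {ε | e.IsRoot ε},
    ((finite_singleton 0).union hdisc).union (Polynomial.finite_setOfPred_isRoot he), ?_⟩
  intro ε hε hT
  simp only [mem_union, mem_singleton_iff, mem_ofPred_eq, not_or, not_and, not_not] at hT
  have hε0 : 0 < ε := hε.lt_of_ne' hT.1.1
  refine analyticAt_of_evalEval_eq_zero (hT.1.2 hε0) ?_
    (hr ε (v ε) hT.2 ((hQ _ _).trans (hPv ε hε))).2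
  filter_upwards [lt_mem_nhds hε0, e.continuous.continuousAt.eventually_ne hT.2] with z hz hez
  exact (hr z (v z) hez ((hQ _ _).trans (hPv z hz.le))).1

end

/-- Under assumption (H1) with `Ω` semi-algebraic, if the feasible set
of problem (P) is nonempty, then the value function `ε ↦ val(P_ε)` is semi-algebraic on
`[0,∞)` (its graph over `[0,∞)`, viewed in `ℝ²`, is semi-algebraic); in particular it is
real-analytic on `[0,∞)` except at finitely many points. -/
theorem statement_5 (n m r s : ℕ)
    (f : MvPolynomial (Fin n ⊕ Fin m) ℝ)
    (g : Fin r → MvPolynomial (Fin n ⊕ Fin m) ℝ)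
    (h : Fin s → MvPolynomial (Fin n ⊕ Fin m) ℝ)
    (φ : MvPolynomial (Fin n ⊕ (Fin m ⊕ Fin m)) ℝ)
    (A B : Set (Fin n ⊕ Fin m → ℝ))
    (hA : A = {z | ∀ i, 0 ≤ eval z (g i)})
    (hB : B = {z | ∀ j, 0 ≤ eval z (h j)})
    (Bx : (Fin n → ℝ) → Set (Fin m → ℝ))
    (hBx : ∀ x, Bx x = {v | ∀ j, 0 ≤ eval (Sum.elim x v) (h j)})
    -- assumption (H1), with Ω semi-algebraic
    (Ω : Set (Fin n ⊕ Fin m → ℝ))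
    (hΩc : IsCompact Ω)
    (hΩsa : IsSemialgebraic Ω)
    (hBΩ : B ⊆ Ω)
    (hne : ∀ x ∈ (fun z : Fin n ⊕ Fin m → ℝ => z ∘ Sum.inl) '' Ω, (Bx x).Nonempty)
    -- the optimal value function J : the minimum is attained and equals J on Ω
    (J : (Fin n ⊕ Fin m → ℝ) → ℝ)
    (hJ : ∀ z ∈ Ω, IsLeast
      ((fun v => eval (Sum.elim (z ∘ Sum.inl) (Sum.elim (z ∘ Sum.inr) v)) φ) ''
        Bx (z ∘ Sum.inl)) (J z))
    -- the feasible set of (P) is nonempty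
    (hfeas : {z | z ∈ A ∩ B ∧ 0 ≤ J z}.Nonempty)
    -- the feasible set of (P_ε)
    (Feas : ℝ → Set (Fin n ⊕ Fin m → ℝ))
    (hFeas : ∀ ε, Feas ε = {z ∈ Ω | (∀ i, -ε ≤ eval z (g i)) ∧
      (∀ j, -ε ≤ eval z (h j)) ∧ -ε ≤ J z})
    -- the value function ε ↦ val(P_ε)
    (valP : ℝ → ℝ)
    (hvalP : ∀ ε, valP ε = sInf ((fun z => eval z f) '' Feas ε)) :
    IsSemialgebraic {w : Fin 2 → ℝ | 0 ≤ w 0 ∧ w 1 = valP (w 0)} ∧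
    ∃ T : Set ℝ, T.Finite ∧ ∀ ε : ℝ, 0 ≤ ε → ε ∉ T → AnalyticAt ℝ valP ε := by
  classical
  obtain ⟨z₀, ⟨hzA, hzB⟩, hzJ⟩ := hfeas
  have hz₀ (ε : ℝ) (hε : 0 ≤ ε) : z₀ ∈ Feas ε := by
    rw [hA] at hzA
    have hzB' := hzB
    rw [hB] at hzB'
    rw [hFeas]
    exact ⟨hBΩ hzB, fun i => (neg_nonpos.2 hε).trans (hzA i),
      fun j => (neg_nonpos.2 hε).trans (hzB' j), (neg_nonpos.2 hε).trans hzJ⟩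
  have hsub (ε : ℝ) : Feas ε ⊆ Ω := by
    rw [hFeas]
    exact fun z hz => hz.1
  have hglb (ε : ℝ) (hε : 0 ≤ ε) :
      IsGLB ((fun z => eval z f) '' {z | z ∈ Feas ε}) (valP ε) := by
    rw [hvalP]
    exact hΩc.isGLB_sInf_eval (hsub ε) ⟨z₀, hz₀ ε hε⟩ f
  have hanti : AntitoneOn valP (Ici 0) := by
    intro a ha b hb hab
    refine (hglb a ha).mono (hglb b hb) (image_mono fun z hz => ?_)
    rw [mem_ofPred_eq, hFeas] at hz ⊢
    exact ⟨hz.1, fun i => (neg_le_neg hab).trans (hz.2.1 i),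
      fun j => (neg_le_neg hab).trans (hz.2.2.1 j), (neg_le_neg hab).trans hz.2.2.2⟩
  have hfeasible (ε : ℝ) (z : Fin n ⊕ Fin m → ℝ) : (z ∈ Ω ∧ (∀ i, -ε ≤ eval z (g i)) ∧
      (∀ j, -ε ≤ eval z (h j)) ∧ ∀ y : Fin m → ℝ,
        (∀ j, 0 ≤ eval (Sum.elim (fun i => z (Sum.inl i)) y) (h j)) →
          -ε ≤ eval (Sum.elim (fun i => z (Sum.inl i))
            (Sum.elim (fun i => z (Sum.inr i)) y)) φ) ↔ z ∈ Feas ε := by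
    rw [hFeas]
    refine and_congr_right fun hz => and_congr_right fun _ => and_congr_right fun _ => ?_
    rw [le_isGLB_iff (hJ z hz).isGLB, mem_lowerBounds, forall_mem_image, hBx]
    rfl
  have hε : IsPolyFun fun w : Option (Fin n ⊕ Fin m) → ℝ => -w none := (IsPolyFun.coord _).neg
  have hε' : IsPolyFun fun w : Option (Fin n ⊕ Fin m) ⊕ Fin m → ℝ => -w (Sum.inl none) :=
    (IsPolyFun.coord _).neg
  have hdet : SignDetermined fun w : Option (Fin n ⊕ Fin m) → ℝ =>
      (fun k => w (some k)) ∈ Feas (w none) := by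
    refine SignDetermined.congr (.and (hΩsa.signDetermined.comp fun i => .coord _)
      (.and (.forall_finite fun i => .le hε (IsPolyFun.eval_comp _ fun k => .coord _))
        (.and (.forall_finite fun j => .le hε (IsPolyFun.eval_comp _ fun k => .coord _))
          (.forall_vec (.imp (.forall_finite fun j => .le (.const 0)
            (IsPolyFun.eval_comp _ ?_)) (.le hε' (IsPolyFun.eval_comp _ ?_)))))))
      fun w => hfeasible (w none) fun k => w (some k)
    · rintro (i | i) <;> exact .coord _
    · rintro (i | i | i) <;> exact .coord _
  have hgraph := SignDetermined.graph_of_isGLB f hdet hglb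
  exact ⟨SignDetermined.isSemialgebraic hgraph, hgraph.exists_finite_analyticAt hanti⟩
end

section
/- Suppose assumption (H1) holds, the feasible set {(x,y) ∈ A ∩ B : J(x,y) ≥ 0} of problem (P) is nonempty, and the function J is continuous on Ω. Then the value function ε ↦ val(P_ε) is right continuous at 0: lim_{ε → 0⁺} val(P_ε) = val(P). -/
open MvPolynomial Set Filter

section RelaxedInfimum

variable {X ι : Type*} [TopologicalSpace X] [T2Space X] {Ω : Set X} {F : X → ℝ} {G : X → ι → ℝ}

/-- A sublevel set of the objective that contains no feasible point contains no
`ε`-feasible point for some `ε > 0`. -/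
theorem exists_relaxation_disjoint_sublevel (hΩ : IsCompact Ω) (hF : ContinuousOn F Ω)
    (hG : ContinuousOn G Ω) {c : ℝ} (hc : ∀ z ∈ Ω, (∀ i, 0 ≤ G z i) → c < F z) :
    ∃ ε > 0, ∀ z ∈ Ω, (∀ i, -ε ≤ G z i) → c < F z := by
  by_contra! hcon
  let K : Ioi (0 : ℝ) → Set X := fun ε =>
    Ω ∩ (fun z => (F z, G z)) ⁻¹' (Iic c ×ˢ Set.pi univ fun _ => Ici (-ε.1))
  have hclosed : ∀ ε, IsClosed (K ε) := fun ε =>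
    (hF.prodMk hG).preimage_isClosed_of_isClosed hΩ.isClosed
      (isClosed_Iic.prod (isClosed_set_pi fun _ _ => isClosed_Ici))
  have hmono : Monotone K := fun a b hab z hz =>
    ⟨hz.1, hz.2.1, fun i hi => (neg_le_neg (Subtype.coe_le_coe.2 hab)).trans (hz.2.2 i hi)⟩
  have : Nonempty (Ioi (0 : ℝ)) := ⟨⟨1, mem_Ioi.2 one_pos⟩⟩
  obtain ⟨z, hz⟩ := IsCompact.nonempty_iInter_of_directed_nonempty_isCompact_isClosed K
    (fun a b => ⟨min a b, hmono (min_le_left a b), hmono (min_le_right a b)⟩)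
    (fun ε => by
      obtain ⟨z, hzΩ, hzG, hzF⟩ := hcon ε.1 ε.2
      exact ⟨z, hzΩ, hzF, fun i _ => hzG i⟩)
    (fun ε => hΩ.of_isClosed_subset (hclosed ε) inter_subset_left) hclosed
  rw [mem_iInter] at hz
  have hz1 := hz ⟨1, mem_Ioi.2 one_pos⟩
  refine (hc z hz1.1 fun i => ?_).not_ge hz1.2.1
  refine le_of_forall_pos_le_add fun ε hε => ?_
  have hi : -ε ≤ G z i := (hz ⟨ε, hε⟩).2.2 i (mem_univ i)
  linarith

/-- The infimum of a continuous function over the relaxed feasible sets of a compact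
problem is right continuous at zero relaxation. -/
theorem tendsto_sInf_image_relaxation (hΩ : IsCompact Ω) (hF : ContinuousOn F Ω)
    (hG : ContinuousOn G Ω) (hne : {z ∈ Ω | ∀ i, 0 ≤ G z i}.Nonempty) :
    Tendsto (fun ε : ℝ => sInf (F '' {z ∈ Ω | ∀ i, -ε ≤ G z i})) (nhdsWithin 0 (Ioi 0))
      (nhds (sInf (F '' {z ∈ Ω | ∀ i, 0 ≤ G z i}))) := by
  have hbdd : ∀ p : X → Prop, BddBelow (F '' {z ∈ Ω | p z}) := fun p =>
    (hΩ.image_of_continuousOn hF).bddBelow.mono (image_mono fun _ hz => hz.1)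
  have hsub : ∀ ε : ℝ, 0 < ε → {z ∈ Ω | ∀ i, 0 ≤ G z i} ⊆ {z ∈ Ω | ∀ i, -ε ≤ G z i} :=
    fun ε hε z hz => ⟨hz.1, fun i => (neg_nonpos.2 hε.le).trans (hz.2 i)⟩
  refine tendsto_order.2 ⟨fun a ha => ?_, fun a ha => ?_⟩
  · obtain ⟨c, hac, hc⟩ := exists_between ha
    obtain ⟨δ, hδ, hδc⟩ := exists_relaxation_disjoint_sublevel hΩ hF hG
      fun z hzΩ hz => hc.trans_le (csInf_le (hbdd _) (mem_image_of_mem F ⟨hzΩ, hz⟩))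
    filter_upwards [Ioo_mem_nhdsGT hδ] with ε hε
    refine hac.trans_le (le_csInf ((hne.mono (hsub ε hε.1)).image F) ?_)
    rintro _ ⟨z, ⟨hzΩ, hz⟩, rfl⟩
    exact (hδc z hzΩ fun i => (neg_le_neg hε.2.le).trans (hz i)).le
  · filter_upwards [self_mem_nhdsWithin] with ε hε
    exact (csInf_le_csInf (hbdd _) (hne.image F) (image_mono (hsub ε hε))).trans_lt ha

end RelaxedInfimum

/-- Under assumption (H1), if the feasible set of (P) is nonempty and
`J` is continuous on `Ω`, then the value function `ε ↦ val(P_ε)` is right continuous at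
`0`: `lim_{ε → 0⁺} val(P_ε) = val(P) = val(P_0)`. -/
theorem statement_7 (n m r s : ℕ)
    (f : MvPolynomial (Fin n ⊕ Fin m) ℝ)
    (g : Fin r → MvPolynomial (Fin n ⊕ Fin m) ℝ)
    (h : Fin s → MvPolynomial (Fin n ⊕ Fin m) ℝ)
    (φ : MvPolynomial (Fin n ⊕ (Fin m ⊕ Fin m)) ℝ)
    (A B : Set (Fin n ⊕ Fin m → ℝ))
    (hA : A = {z | ∀ i, 0 ≤ eval z (g i)})
    (hB : B = {z | ∀ j, 0 ≤ eval z (h j)})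
    (Bx : (Fin n → ℝ) → Set (Fin m → ℝ))
    (hBx : ∀ x, Bx x = {v | ∀ j, 0 ≤ eval (Sum.elim x v) (h j)})
    -- assumption (H1)
    (Ω : Set (Fin n ⊕ Fin m → ℝ))
    (hΩc : IsCompact Ω) (hBΩ : B ⊆ Ω)
    (hne : ∀ x ∈ (fun z : Fin n ⊕ Fin m → ℝ => z ∘ Sum.inl) '' Ω, (Bx x).Nonempty)
    -- the optimal value function J : the minimum is attained and equals J on Ω
    (J : (Fin n ⊕ Fin m → ℝ) → ℝ)
    (hJ : ∀ z ∈ Ω, IsLeast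
      ((fun v => eval (Sum.elim (z ∘ Sum.inl) (Sum.elim (z ∘ Sum.inr) v)) φ) ''
        Bx (z ∘ Sum.inl)) (J z))
    -- J is continuous on Ω
    (hJcont : ContinuousOn J Ω)
    -- the feasible set of (P) is nonempty
    (hfeas : {z | z ∈ A ∩ B ∧ 0 ≤ J z}.Nonempty)
    -- the feasible set of (P_ε)
    (Feas : ℝ → Set (Fin n ⊕ Fin m → ℝ))
    (hFeas : ∀ ε, Feas ε = {z ∈ Ω | (∀ i, -ε ≤ eval z (g i)) ∧
      (∀ j, -ε ≤ eval z (h j)) ∧ -ε ≤ J z})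
    -- the value function ε ↦ val(P_ε)
    (valP : ℝ → ℝ)
    (hvalP : ∀ ε, valP ε = sInf ((fun z => eval z f) '' Feas ε)) :
    Tendsto valP (nhdsWithin 0 (Set.Ioi 0)) (nhds (valP 0)) := by
  let G : (Fin n ⊕ Fin m → ℝ) → (Fin r ⊕ Fin s) ⊕ Unit → ℝ := fun z =>
    Sum.elim (Sum.elim (fun i => eval z (g i)) fun j => eval z (h j)) fun _ => J z
  have hG : ContinuousOn G Ω := by
    refine continuousOn_pi.2 ?_
    rintro ((i | j) | _)
    · exact (MvPolynomial.continuous_eval (g i)).continuousOn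
    · exact (MvPolynomial.continuous_eval (h j)).continuousOn
    · exact hJcont
  have hFeasG : ∀ ε, Feas ε = {z ∈ Ω | ∀ i, -ε ≤ G z i} := fun ε => by
    rw [hFeas]
    ext z
    simp [G, and_assoc]
  have hFeas_zero : Feas 0 = {z ∈ Ω | ∀ i, 0 ≤ G z i} := by
    simpa only [neg_zero] using hFeasG 0
  have hnonempty : (Feas 0).Nonempty := by
    obtain ⟨z, ⟨hzA, hzB⟩, hzJ⟩ := hfeas
    have hzΩ := hBΩ hzB
    rw [hA] at hzA
    rw [hB] at hzB
    rw [hFeas, neg_zero]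
    exact ⟨z, hzΩ, hzA, hzB, hzJ⟩
  have hlim := tendsto_sInf_image_relaxation hΩc
    (MvPolynomial.continuous_eval f).continuousOn hG (hFeas_zero ▸ hnonempty)
  simpa only [← hFeasG, ← hFeas_zero, ← hvalP] using hlim
end

section
/- Suppose assumptions (H1) and (H2) hold, where Ω := {(x,y) ∈ ℝ^n × ℝ^m : M − x_j² ≥ 0 (j = 1,…,n), M − y_j² ≥ 0 (j = 1,…,m)} is a box containing B, and let μ be the uniform (normalized Lebesgue) probability measure on Ω. Then there exists a sequence of polynomials J_k ∈ ℝ[x,y], k ∈ ℕ, with deg J_k ≤ 2k, such that J_k(z) ≤ J(z) for all z ∈ Ω and lim_{k→∞} ∫_Ω |J_k(z) − J(z)| dμ(z) = 0, i.e., J_k → J in the L¹(Ω,μ)-norm. -/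
open MvPolynomial Set Filter MeasureTheory

/-- Stone–Weierstrass for multivariate polynomials on a compact set. -/
lemma MvPolynomial.exists_near_of_isCompact {ι : Type*} {f : (ι → ℝ) → ℝ} (hf : Continuous f)
    {K : Set (ι → ℝ)} (hK : IsCompact K) {ε : ℝ} (hε : 0 < ε) :
    ∃ p : MvPolynomial ι ℝ, ∀ z ∈ K, |eval z p - f z| < ε := by
  let X' : ι → C(ι → ℝ, ℝ) := fun i => ⟨fun z => z i, continuous_apply i⟩
  have hsep : (aeval (R := ℝ) X').range.SeparatesPoints := by
    intro x y hxy
    obtain ⟨i, hi⟩ := Function.ne_iff.mp hxy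
    exact ⟨X' i, ⟨X' i, ⟨X i, by simp⟩, rfl⟩, hi⟩
  obtain ⟨g, ⟨p, rfl⟩, hg⟩ :=
    ContinuousMap.exists_mem_subalgebra_near_continuous_of_isCompact_of_separatesPoints
      hsep ⟨f, hf⟩ hK hε
  have key : ∀ (z : ι → ℝ) (q : MvPolynomial ι ℝ), (aeval (R := ℝ) X' q) z = eval z q := by
    intro z q
    induction q using MvPolynomial.induction_on with
    | C a => simp
    | add p q hp hq => simp [hp, hq]
    | mul_X p i hp => simp [hp, X']
  refine ⟨p, fun z hz => ?_⟩
  have := hg z hz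
  rw [Real.norm_eq_abs] at this
  simpa [key] using this

lemma isCompact_setOf_forall_sq_le (ι : Type*) (M : ℝ) :
    IsCompact {z : ι → ℝ | ∀ i, z i ^ 2 ≤ M} := by
  have hsub : {z : ι → ℝ | ∀ i, z i ^ 2 ≤ M} ⊆ Set.univ.pi fun _ => Icc (-√M) (√M) := by
    intro z hz i _
    exact ⟨Real.neg_sqrt_le_of_sq_le (hz i), Real.le_sqrt_of_sq_le (hz i)⟩
  refine (isCompact_univ_pi fun _ => isCompact_Icc).of_isClosed_subset ?_ hsub
  simp only [ofPred_forall]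
  exact isClosed_iInter fun i => isClosed_le (by fun_prop) continuous_const

/-- The value function of a constrained minimization problem is the pointwise limit, from below,
of the value functions of its penalized problems, and these are continuous. -/
lemma exists_continuous_tendsto_of_isLeast {Z V : Type*} [TopologicalSpace Z] [TopologicalSpace V]
    {K : Set V} (hK : IsCompact K) (hKne : K.Nonempty) {F g : Z → V → ℝ}
    (hF : Continuous F.uncurry) (hg : Continuous g.uncurry) (hg0 : ∀ z v, 0 ≤ g z v)
    {Ω : Set Z} {J : Z → ℝ}
    (hJ : ∀ z ∈ Ω, IsLeast (F z '' {v ∈ K | g z v = 0}) (J z)) :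
    ∃ f : ℕ → Z → ℝ, (∀ N, Continuous (f N)) ∧ (∀ N, ∀ z ∈ Ω, f N z ≤ J z) ∧
      (∀ z ∈ Ω, Tendsto (fun N => f N z) atTop (nhds (J z))) ∧
      ∀ N z c, (∀ v ∈ K, c ≤ F z v) → c ≤ f N z := by
  let G : ℕ → Z → V → ℝ := fun N z v => F z v + N * g z v
  have hG : ∀ N, Continuous (G N).uncurry := fun N => hF.add (continuous_const.mul hg)
  have hGz : ∀ N z, Continuous (G N z) := fun N z => (hG N).comp (Continuous.prodMk_right z)
  have hle : ∀ N, ∀ z ∈ Ω, sInf (G N z '' K) ≤ J z := by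
    intro N z hz
    obtain ⟨v, ⟨hv, hv0⟩, hvJ⟩ := (hJ z hz).1
    have : G N z v = J z := by simp [G, hv0, hvJ]
    rw [← this]
    exact csInf_le (hK.image (hGz N z)).bddBelow (mem_image_of_mem _ hv)
  refine ⟨fun N z => sInf (G N z '' K), fun N => hK.continuous_sInf (hG N), hle, ?_, ?_⟩
  · intro z hz
    have hFz : Continuous (F z) := hF.comp (Continuous.prodMk_right z)
    have hgz : Continuous (g z) := hg.comp (Continuous.prodMk_right z)
    rw [Metric.tendsto_atTop]
    intro ε hε
    suffices h : ∃ N₀ : ℕ, ∀ N ≥ N₀, ∀ v ∈ K, J z - ε / 2 ≤ G N z v by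
      obtain ⟨N₀, hN₀⟩ := h
      refine ⟨N₀, fun N hN => ?_⟩
      have h1 : J z - ε / 2 ≤ sInf (G N z '' K) :=
        le_csInf (hKne.image _) (forall_mem_image.mpr (hN₀ N hN))
      rw [Real.dist_eq, abs_lt]
      constructor <;> linarith [hle N z hz]
    have hS : IsCompact (K ∩ {v | F z v ≤ J z - ε / 2}) :=
      hK.inter_right (isClosed_le hFz continuous_const)
    rcases (K ∩ {v | F z v ≤ J z - ε / 2}).eq_empty_or_nonempty with he | hne
    · refine ⟨0, fun N _ v hv => ?_⟩
      have h1 : ¬ F z v ≤ J z - ε / 2 := fun h => by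
        have : v ∈ (∅ : Set V) := he ▸ ⟨hv, h⟩
        exact this
      have h2 : 0 ≤ (N : ℝ) * g z v := mul_nonneg N.cast_nonneg (hg0 z v)
      simp only [G]
      linarith
    · obtain ⟨w, hw, hwmin⟩ := hS.exists_isMinOn hne hgz.continuousOn
      have hwpos : 0 < g z w := by
        refine lt_of_le_of_ne (hg0 z w) fun h0 => ?_
        have h1 : J z ≤ F z w := (hJ z hz).2 ⟨w, ⟨hw.1, h0.symm⟩, rfl⟩
        have h2 : F z w ≤ J z - ε / 2 := hw.2
        linarith
      obtain ⟨c, hc⟩ := (hK.image hFz).bddBelow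
      obtain ⟨N₀, hN₀⟩ := exists_nat_ge ((J z - c) / g z w)
      refine ⟨N₀, fun N hN v hv => ?_⟩
      have h2 : 0 ≤ (N : ℝ) * g z v := mul_nonneg N.cast_nonneg (hg0 z v)
      simp only [G]
      by_cases hvS : F z v ≤ J z - ε / 2
      · have h3 : g z w ≤ g z v := hwmin ⟨hv, hvS⟩
        have h4 : c ≤ F z v := hc (mem_image_of_mem _ hv)
        have h5 : J z - c ≤ N₀ * g z w := (div_le_iff₀ hwpos).mp hN₀
        have h6 : (N₀ : ℝ) * g z w ≤ N * g z v :=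
          mul_le_mul (by exact_mod_cast hN) h3 hwpos.le N.cast_nonneg
        linarith
      · linarith
  · intro N z c hc
    refine le_csInf (hKne.image _) (forall_mem_image.mpr fun v hv => ?_)
    have h2 : 0 ≤ (N : ℝ) * g z v := mul_nonneg N.cast_nonneg (hg0 z v)
    have := hc v hv
    simp only [G]
    linarith

/-- Elements of unbounded degree can be rearranged, with repetitions, into a sequence of elements
of degree at most `2 * k`. -/
lemma exists_tendsto_atTop_degree_le {d : ℕ → ℕ} (hd : d 0 = 0) :
    ∃ r : ℕ → ℕ, Tendsto r atTop atTop ∧ ∀ k, d (r k) ≤ 2 * k := by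
  refine ⟨fun k => Nat.findGreatest (fun N => d N ≤ 2 * k) k, ?_, fun k => ?_⟩
  · refine tendsto_atTop.mpr fun N => ?_
    filter_upwards [eventually_ge_atTop (max N (d N))] with k hk
    have h1 := le_of_max_le_left hk
    have h2 := le_of_max_le_right hk
    exact Nat.le_findGreatest h1 (by omega)
  · exact Nat.findGreatest_spec (P := fun N => d N ≤ 2 * k) (Nat.zero_le k) (by simp [hd])

/-- Under assumptions (H1) and (H2), with `Ω` the box
`{(x,y) : M − x_j² ≥ 0, M − y_j² ≥ 0}` containing `B` and `μ` the uniform (normalized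
Lebesgue) probability measure on `Ω`, there is a sequence of polynomials `J_k` of degree
at most `2k` with `J_k ≤ J` on `Ω` and `J_k → J` in the `L¹(Ω,μ)`-norm. Points `(x,y)`
are encoded as `z : Fin n ⊕ Fin m → ℝ`. -/
theorem statement_11 (n m s : ℕ)
    (h : Fin s → MvPolynomial (Fin n ⊕ Fin m) ℝ)
    (φ : MvPolynomial (Fin n ⊕ (Fin m ⊕ Fin m)) ℝ)
    (B : Set (Fin n ⊕ Fin m → ℝ))
    (hB : B = {z | ∀ j, 0 ≤ eval z (h j)})
    (Bx : (Fin n → ℝ) → Set (Fin m → ℝ))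
    (hBx : ∀ x, Bx x = {v | ∀ j, 0 ≤ eval (Sum.elim x v) (h j)})
    -- Ω is the box {z : z_i² ≤ M for all coordinates}, and it contains B
    (M : ℝ) (hM : 0 < M)
    (Ω : Set (Fin n ⊕ Fin m → ℝ))
    (hΩ : Ω = {z | ∀ i, z i ^ 2 ≤ M})
    (hBΩ : B ⊆ Ω)
    -- assumption (H1)
    (hne : ∀ x ∈ (fun z : Fin n ⊕ Fin m → ℝ => z ∘ Sum.inl) '' Ω, (Bx x).Nonempty)
    -- assumption (H2): the system {h_1,…,h_s} satisfies the Archimedean property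
    (hH2 : ∃ R : ℝ, 0 < R ∧
      ∃ (σ0 : MvPolynomial (Fin n ⊕ Fin m) ℝ) (σ : Fin s → MvPolynomial (Fin n ⊕ Fin m) ℝ),
        IsSumSq σ0 ∧ (∀ j, IsSumSq (σ j)) ∧
        (C R : MvPolynomial (Fin n ⊕ Fin m) ℝ) - ∑ i, X i ^ 2 = σ0 + ∑ j, σ j * h j)
    -- the optimal value function J : the minimum is attained and equals J on Ω
    (J : (Fin n ⊕ Fin m → ℝ) → ℝ)
    (hJ : ∀ z ∈ Ω, IsLeast
      ((fun v => eval (Sum.elim (z ∘ Sum.inl) (Sum.elim (z ∘ Sum.inr) v)) φ) ''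
        Bx (z ∘ Sum.inl)) (J z))
    -- μ is the uniform probability measure on Ω
    (μ : Measure (Fin n ⊕ Fin m → ℝ))
    (hμ : μ = (volume Ω)⁻¹ • volume.restrict Ω) :
    ∃ Jk : ℕ → MvPolynomial (Fin n ⊕ Fin m) ℝ,
      (∀ k, (Jk k).totalDegree ≤ 2 * k) ∧
      (∀ k, ∀ z ∈ Ω, eval z (Jk k) ≤ J z) ∧
      Tendsto (fun k => ∫ z, |eval z (Jk k) - J z| ∂μ) atTop (nhds 0) := by
  subst hB hΩ hμ
  set Ω : Set (Fin n ⊕ Fin m → ℝ) := {z | ∀ i, z i ^ 2 ≤ M} with hΩ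
  have hΩc : IsCompact Ω := isCompact_setOf_forall_sq_le _ M
  set K : Set (Fin m → ℝ) := {v | ∀ i, v i ^ 2 ≤ M} with hKdef
  have hKc : IsCompact K := isCompact_setOf_forall_sq_le _ M
  have hKne : K.Nonempty := ⟨0, fun i => by simpa using hM.le⟩
  let F : (Fin n ⊕ Fin m → ℝ) → (Fin m → ℝ) → ℝ :=
    fun z v => eval (Sum.elim (z ∘ Sum.inl) (Sum.elim (z ∘ Sum.inr) v)) φ
  let g : (Fin n ⊕ Fin m → ℝ) → (Fin m → ℝ) → ℝ :=
    fun z v => ∑ j, max 0 (-eval (Sum.elim (z ∘ Sum.inl) v) (h j))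
  have hF : Continuous F.uncurry := by
    refine (continuous_eval φ).comp (continuous_pi fun i => ?_)
    rcases i with i | i | i <;> simp only [Sum.elim_inl, Sum.elim_inr, Function.comp] <;> fun_prop
  have hg : Continuous g.uncurry := by
    refine continuous_finsetSum _ fun j _ => continuous_const.max (Continuous.neg ?_)
    refine (continuous_eval (h j)).comp (continuous_pi fun i => ?_)
    rcases i with i | i <;> simp only [Sum.elim_inl, Sum.elim_inr, Function.comp] <;> fun_prop
  have hg0 : ∀ z v, 0 ≤ g z v := fun z v => Finset.sum_nonneg fun j _ => le_max_left _ _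
  have hfeas : ∀ z, Bx (z ∘ Sum.inl) = {v ∈ K | g z v = 0} := by
    intro z
    ext v
    have hiff : g z v = 0 ↔ v ∈ Bx (z ∘ Sum.inl) := by
      rw [hBx, Finset.sum_eq_zero_iff_of_nonneg fun j _ => le_max_left _ _]
      simp
    refine ⟨fun hv => ⟨fun i => ?_, hiff.mpr hv⟩, fun hv => hiff.mp hv.2⟩
    rw [hBx] at hv
    exact hBΩ hv (Sum.inr i)
  obtain ⟨f, hfc, hfJ, hflim, hflow⟩ := exists_continuous_tendsto_of_isLeast (F := F) (J := J)
    (Ω := Ω) hKc hKne hF hg hg0 fun z hz => by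
      rw [← hfeas z]
      exact hJ z hz
  obtain ⟨c, hc⟩ : ∃ c, ∀ z ∈ Ω, ∀ v ∈ K, |F z v| ≤ c := by
    obtain ⟨c, hc⟩ := (hΩc.prod hKc).exists_bound_of_continuousOn hF.continuousOn
    exact ⟨c, fun z hz v hv => hc (z, v) ⟨hz, hv⟩⟩
  have hJle : ∀ z ∈ Ω, J z ≤ c := by
    intro z hz
    obtain ⟨v, hv, hvJ⟩ := (hJ z hz).1
    rw [hfeas z] at hv
    rw [← hvJ]
    exact (abs_le.mp (hc z hz v hv.1)).2
  have hlow : ∀ N, ∀ z ∈ Ω, -c ≤ f N z := fun N z hz =>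
    hflow N z _ fun v hv => (abs_le.mp (hc z hz v hv)).1
  have happrox : ∀ N : ℕ, ∃ q : MvPolynomial (Fin n ⊕ Fin m) ℝ, (N = 0 → q.totalDegree = 0) ∧
      (∀ z ∈ Ω, eval z q ≤ J z ∧ -c - 2 ≤ eval z q) ∧
      (N ≠ 0 → ∀ z ∈ Ω, f N z - 2 * (1 / ((N : ℝ) + 1)) ≤ eval z q) := by
    intro N
    rcases eq_or_ne N 0 with rfl | hN
    · refine ⟨C (-c), fun _ => totalDegree_C _, fun z hz => ?_, fun h => absurd rfl h⟩
      rw [eval_C]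
      exact ⟨(hlow 0 z hz).trans (hfJ 0 z hz), by linarith⟩
    · have hpos : 0 < 1 / ((N : ℝ) + 1) := Nat.one_div_pos_of_nat
      have hle1 : 1 / ((N : ℝ) + 1) ≤ 1 := by
        rw [div_le_one (by positivity)]
        linarith [N.cast_nonneg (α := ℝ)]
      obtain ⟨q, hq⟩ := MvPolynomial.exists_near_of_isCompact
        (f := fun z => f N z - 1 / ((N : ℝ) + 1)) ((hfc N).sub continuous_const) hΩc hpos
      refine ⟨q, fun h => absurd h hN, fun z hz => ⟨?_, ?_⟩, fun _ z hz => ?_⟩ <;>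
        have h1 := abs_lt.mp (hq z hz) <;> linarith [hfJ N z hz, hlow N z hz, h1.1, h1.2]
  choose q hq0 hqb hqf using happrox
  have hqlim : ∀ z ∈ Ω, Tendsto (fun N => eval z (q N)) atTop (nhds (J z)) := by
    intro z hz
    have hl : Tendsto (fun N : ℕ => f N z - 2 * (1 / ((N : ℝ) + 1))) atTop (nhds (J z)) := by
      simpa using (hflim z hz).sub (tendsto_one_div_add_atTop_nhds_zero_nat.const_mul (2 : ℝ))
    refine tendsto_of_tendsto_of_tendsto_of_le_of_le' hl tendsto_const_nhds ?_
      (Eventually.of_forall fun N => (hqb N z hz).1)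
    filter_upwards [eventually_ne_atTop 0] with N hN
    exact hqf N hN z hz
  obtain ⟨r, hr, hdeg⟩ := exists_tendsto_atTop_degree_le (d := fun N => (q N).totalDegree) (hq0 0 rfl)
  refine ⟨fun k => q (r k), hdeg, fun k z hz => (hqb _ z hz).1, ?_⟩
  suffices hN : Tendsto (fun N => ∫ z in Ω, |eval z (q N) - J z|) atTop (nhds 0) by
    have := (hN.comp hr).const_smul (volume Ω)⁻¹.toReal
    simpa only [integral_smul_measure, smul_zero, Function.comp_def] using this
  have hΩm : MeasurableSet Ω := hΩc.measurableSet
  have hqm : ∀ N, AEStronglyMeasurable (fun z => eval z (q N)) (volume.restrict Ω) := fun N =>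
    (continuous_eval (q N)).aestronglyMeasurable
  have hJm : AEStronglyMeasurable J (volume.restrict Ω) :=
    aestronglyMeasurable_of_tendsto_ae atTop hqm (ae_restrict_of_forall_mem hΩm hqlim)
  have hlim0 := tendsto_integral_of_dominated_convergence (μ := volume.restrict Ω)
    (F := fun N z => |eval z (q N) - J z|) (f := fun _ => 0) (fun _ => 2 * c + 2)
    (fun N => ((hqm N).sub hJm).norm)
    (integrableOn_const hΩc.measure_lt_top.ne)
    (fun N => ae_restrict_of_forall_mem hΩm fun z hz => ?_)
    (ae_restrict_of_forall_mem hΩm fun z hz => ?_)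
  · simpa using hlim0
  · rw [Real.norm_eq_abs, abs_abs, abs_le]
    have h1 := hqb N z hz
    have h2 := hJle z hz
    have h3 := (hlow 0 z hz).trans (hfJ 0 z hz)
    constructor <;> linarith [h1.1, h1.2]
  · simpa using ((hqlim z hz).sub_const (J z)).abs
end

section
/- Suppose assumption (H1) holds, the feasible set {(x,y) ∈ A ∩ B : J(x,y) ≥ 0} of problem (MPEC) is nonempty, and (J_k) is a sequence of polynomials with J_k(z) ≤ J(z) for all z ∈ Ω and J_k → J in L¹(Ω,μ). Then for every fixed ε > 0 there exists an integer k_ε > 0 such that for all k ≥ k_ε, the set S_i is nonempty for some i ≤ k and v_ε^k < f_* + ε, where f_* is the optimal value of problem (MPEC). -/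
open MvPolynomial Set Filter MeasureTheory

/-- A box `{z | ∀ i, z i ^ 2 ≤ M}` is a closed ball for the sup norm. -/
theorem setOf_forall_sq_le_eq_closedBall {ι : Type*} [Fintype ι] {M : ℝ} (hM : 0 ≤ M) :
    {z : ι → ℝ | ∀ i, z i ^ 2 ≤ M} = Metric.closedBall 0 (√M) := by
  ext z
  simp only [mem_closedBall_zero_iff, pi_norm_le_iff_of_nonneg (Real.sqrt_nonneg M),
    Real.norm_eq_abs, ← Real.sqrt_sq_eq_abs, Real.sqrt_le_sqrt_iff hM, mem_ofPred_eq]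

/-- The sublevel sets of the value function of a continuous parametric minimization problem over
a compact set are compact. -/
theorem isCompact_sublevel_of_isLeast {X Y : Type*} [TopologicalSpace X] [TopologicalSpace Y]
    {K : Set (X × Y)} (hK : IsCompact K) {F : X × Y → ℝ} (hF : Continuous F)
    {S : Set X} {J : X → ℝ} (hKS : ∀ p ∈ K, p.1 ∈ S)
    (hJ : ∀ x ∈ S, IsLeast ((fun y => F (x, y)) '' {y | (x, y) ∈ K}) (J x)) (c : ℝ) :
    IsCompact {x ∈ S | J x ≤ c} := by
  have heq : {x ∈ S | J x ≤ c} = Prod.fst '' (K ∩ {p | F p ≤ c}) := by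
    ext x
    constructor
    · rintro ⟨hx, hxc⟩
      obtain ⟨y, hy, hyJ⟩ := (hJ x hx).1
      exact ⟨(x, y), ⟨hy, hyJ.trans_le hxc⟩, rfl⟩
    · rintro ⟨⟨x, y⟩, ⟨hp, hpc⟩, rfl⟩
      exact ⟨hKS _ hp, ((hJ x (hKS _ hp)).2 ⟨y, hp, rfl⟩).trans hpc⟩
  rw [heq]
  exact (hK.inter_right (isClosed_le hF continuous_const)).image continuous_fst

/-- A function with measurable sublevel sets inside `S` is a.e. measurable on `S`. -/
theorem aemeasurable_restrict_of_sublevel {X : Type*} [MeasurableSpace X] {ν : Measure X}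
    {S : Set X} (hS : MeasurableSet S) {J : X → ℝ}
    (hJ : ∀ c, MeasurableSet {x ∈ S | J x ≤ c}) : AEMeasurable J (ν.restrict S) := by
  refine (aemeasurable_restrict_iff_comap_subtype hS).2 (Measurable.aemeasurable ?_)
  refine measurable_of_Iic fun c => ?_
  convert (measurable_subtype_coe (hJ c)) using 1
  ext x
  simp

/-- If the functions `u k` converge to `J` in `L¹`, then on any set of positive measure
`J - δ ≤ u k` holds somewhere for all large `k`. -/
theorem eventually_exists_sub_le {X : Type*} [MeasurableSpace X] {ν : Measure X}
    [IsFiniteMeasure ν] {U : Set X} (hU : 0 < ν.real U) {u : ℕ → X → ℝ} {J : X → ℝ}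
    (hint : ∀ k, Integrable (fun x => |u k x - J x|) ν)
    (hconv : Tendsto (fun k => ∫ x, |u k x - J x| ∂ν) atTop (nhds 0)) {δ : ℝ} (hδ : 0 < δ) :
    ∀ᶠ k in atTop, ∃ x ∈ U, J x - δ ≤ u k x := by
  filter_upwards [hconv.eventually_lt_const (mul_pos hδ hU)] with k hk
  by_contra! hcon
  refine hk.not_ge ?_
  calc δ * ν.real U ≤ δ * ν.real {x | δ ≤ |u k x - J x|} := by
        gcongr
        · exact measure_ne_top _ _
        · intro x hx
          have h1 := hcon x hx
          have h2 := neg_le_abs (u k x - J x)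
          simp only [mem_ofPred_eq]
          linarith
    _ ≤ _ := mul_meas_ge_le_integral_of_nonneg (ae_of_all _ fun _ => abs_nonneg _) (hint k) δ

/-- (Lemma 4(i).) Under assumption (H1) with `Ω` a box, if the feasible
set of (MPEC) is nonempty and `(J_k)` is a sequence of polynomials with `J_k ≤ J` on `Ω`
and `J_k → J` in `L¹(Ω,μ)`, then for every fixed `ε > 0` there is an integer `k_ε > 0`
such that for all `k ≥ k_ε` the set `S_i` is nonempty for some `1 ≤ i ≤ k` and
`v_ε^k < f_* + ε`.  Values of subproblems are taken in `EReal` (so `inf ∅ = +∞`), and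
`v_ε^k := min_{1 ≤ i ≤ k} val(P_ε^i)`. Points `(x,y)` are encoded as
`z : Fin n ⊕ Fin m → ℝ`. -/
theorem statement_12 (n m r s : ℕ)
    (f : MvPolynomial (Fin n ⊕ Fin m) ℝ)
    (g : Fin r → MvPolynomial (Fin n ⊕ Fin m) ℝ)
    (h : Fin s → MvPolynomial (Fin n ⊕ Fin m) ℝ)
    (φ : MvPolynomial (Fin n ⊕ (Fin m ⊕ Fin m)) ℝ)
    (A B : Set (Fin n ⊕ Fin m → ℝ))
    (hA : A = {z | ∀ i, 0 ≤ eval z (g i)})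
    (hB : B = {z | ∀ j, 0 ≤ eval z (h j)})
    (Bx : (Fin n → ℝ) → Set (Fin m → ℝ))
    (hBx : ∀ x, Bx x = {v | ∀ j, 0 ≤ eval (Sum.elim x v) (h j)})
    -- Ω is the box {z : z_i² ≤ M for all coordinates}, and it contains B
    (M : ℝ) (hM : 0 < M)
    (Ω : Set (Fin n ⊕ Fin m → ℝ))
    (hΩ : Ω = {z | ∀ i, z i ^ 2 ≤ M})
    (hBΩ : B ⊆ Ω)
    -- assumption (H1)
    (hne : ∀ x ∈ (fun z : Fin n ⊕ Fin m → ℝ => z ∘ Sum.inl) '' Ω, (Bx x).Nonempty)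
    -- the optimal value function J : the minimum is attained and equals J on Ω
    (J : (Fin n ⊕ Fin m → ℝ) → ℝ)
    (hJ : ∀ z ∈ Ω, IsLeast
      ((fun v => eval (Sum.elim (z ∘ Sum.inl) (Sum.elim (z ∘ Sum.inr) v)) φ) ''
        Bx (z ∘ Sum.inl)) (J z))
    -- μ is the uniform probability measure on Ω
    (μ : Measure (Fin n ⊕ Fin m → ℝ))
    (hμ : μ = (volume Ω)⁻¹ • volume.restrict Ω)
    -- the feasible set of (MPEC) is nonempty, and f_* is its optimal value
    (Feas : Set (Fin n ⊕ Fin m → ℝ))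
    (hFeas : Feas = {z | z ∈ A ∩ B ∧ 0 ≤ J z})
    (hFne : Feas.Nonempty)
    (fstar : ℝ)
    (hfstar : fstar = sInf ((fun z => eval z f) '' Feas))
    -- the sequence (J_k): below J on Ω and converging to J in L¹(Ω,μ)
    (Jk : ℕ → MvPolynomial (Fin n ⊕ Fin m) ℝ)
    (hJkle : ∀ k, ∀ z ∈ Ω, eval z (Jk k) ≤ J z)
    (hJkconv : Tendsto (fun k => ∫ z, |eval z (Jk k) - J z| ∂μ) atTop (nhds 0))
    -- ε > 0 fixed
    (ε : ℝ) (hε : 0 < ε)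
    -- the sets S_k and the values val(P_ε^k) (in EReal, so that inf ∅ = +∞) and v_ε^k
    (Sk : ℕ → Set (Fin n ⊕ Fin m → ℝ))
    (hSk : ∀ k, Sk k = {z ∈ Ω | (∀ i, -ε ≤ eval z (g i)) ∧
      (∀ j, -ε ≤ eval z (h j)) ∧ -ε ≤ eval z (Jk k)})
    (valPk : ℕ → EReal)
    (hvalPk : ∀ k, valPk k = sInf ((fun z => ((eval z f : ℝ) : EReal)) '' Sk k))
    (v : ℕ → EReal)
    (hv : ∀ k, v k = ⨅ i ∈ Finset.Icc 1 k, valPk i) :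
    ∃ kε : ℕ, 0 < kε ∧ ∀ k, kε ≤ k →
      (∃ i, 1 ≤ i ∧ i ≤ k ∧ (Sk i).Nonempty) ∧
      v k < ((fstar + ε : ℝ) : EReal) := by
  have hball : Ω = Metric.closedBall 0 (√M) :=
    hΩ.trans (setOf_forall_sq_le_eq_closedBall hM.le)
  have hsM : 0 < √M := Real.sqrt_pos.2 hM
  have hΩc : IsCompact Ω := hball ▸ isCompact_closedBall _ _
  have hBcl : IsClosed B := by
    rw [hB, ofPred_forall]
    exact isClosed_iInter fun j => isClosed_le continuous_const (continuous_eval (h j))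
  set E : (Fin n ⊕ Fin m → ℝ) × (Fin m → ℝ) → (Fin n ⊕ Fin m → ℝ) :=
    fun p => Sum.elim (p.1 ∘ Sum.inl) p.2 with hE
  have hEc : Continuous E := by
    refine continuous_pi fun i => ?_
    rcases i with i | i <;> simp only [hE, Sum.elim_inl, Sum.elim_inr, Function.comp] <;> fun_prop
  set F : (Fin n ⊕ Fin m → ℝ) × (Fin m → ℝ) → ℝ :=
    fun p => eval (Sum.elim (p.1 ∘ Sum.inl) (Sum.elim (p.1 ∘ Sum.inr) p.2)) φ with hF
  have hFc : Continuous F := by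
    refine (continuous_eval φ).comp (continuous_pi fun i => ?_)
    rcases i with i | i | i <;> simp only [Sum.elim_inl, Sum.elim_inr, Function.comp] <;> fun_prop
  set K : Set ((Fin n ⊕ Fin m → ℝ) × (Fin m → ℝ)) := {p | p.1 ∈ Ω ∧ E p ∈ B} with hK
  have hKc : IsCompact K := by
    refine IsCompact.of_isClosed_subset (hΩc.prod (isCompact_closedBall (0 : Fin m → ℝ) (√M)))
      ((hΩc.isClosed.preimage continuous_fst).inter (hBcl.preimage hEc)) ?_
    rintro ⟨z, v⟩ ⟨hz, hv⟩
    refine ⟨hz, ?_⟩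
    have := hBΩ hv
    rw [hΩ] at this
    rw [← setOf_forall_sq_le_eq_closedBall hM.le]
    exact fun i => this (Sum.inr i)
  have hJ' : ∀ z ∈ Ω, IsLeast ((fun v => F (z, v)) '' {v | (z, v) ∈ K}) (J z) := by
    intro z hz
    have : {v | (z, v) ∈ K} = Bx (z ∘ Sum.inl) := by
      ext v
      simp [hK, hz, hBx, hB, hE]
    rw [this]
    exact hJ z hz
  have hsub := isCompact_sublevel_of_isLeast hKc hFc (fun p hp => hp.1) hJ'
  obtain ⟨C, hC⟩ := (hKc.bddAbove_image hFc.abs.continuousOn)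
  have hJbd : ∀ z ∈ Ω, |J z| ≤ C := by
    intro z hz
    obtain ⟨v, hv, hvJ⟩ := (hJ' z hz).1
    rw [← hvJ]
    exact hC ⟨_, hv, rfl⟩
  have hvol : volume Ω ≠ ⊤ := hΩc.measure_lt_top.ne
  have hfin : IsFiniteMeasure (volume.restrict Ω) := ⟨by simpa using hΩc.measure_lt_top⟩
  have hpos : volume Ω ≠ 0 := by
    rw [hball]
    exact (Metric.measure_closedBall_pos volume _ hsM).ne'
  have hfinμ : IsFiniteMeasure μ := by
    rw [hμ]
    exact Measure.smul_finite _ (ENNReal.inv_ne_top.2 hpos)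
  have hJint : Integrable J (volume.restrict Ω) :=
    Integrable.of_bound (aemeasurable_restrict_of_sublevel hΩc.measurableSet
      fun c => (hsub c).measurableSet).aestronglyMeasurable C
      ((ae_restrict_iff' hΩc.measurableSet).2 (ae_of_all _ hJbd))
  have hint : ∀ k, Integrable (fun z => |eval z (Jk k) - J z|) μ := by
    intro k
    rw [hμ]
    refine Integrable.smul_measure ?_ (ENNReal.inv_ne_top.2 hpos)
    exact (((continuous_eval (Jk k)).continuousOn.integrableOn_compact hΩc).sub hJint).abs
  obtain ⟨_, ⟨z₀, hz₀, rfl⟩, hfz₀⟩ := exists_lt_of_csInf_lt (hFne.image fun z => eval z f)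
    (hfstar ▸ lt_add_of_pos_right fstar hε : sInf ((fun z => eval z f) '' Feas) < fstar + ε)
  rw [hFeas, hA, hB] at hz₀
  obtain ⟨⟨hgz₀, hhz₀⟩, hJz₀⟩ := hz₀
  set O : Set (Fin n ⊕ Fin m → ℝ) :=
    (({z | ∀ i, -ε < eval z (g i)} ∩ {z | ∀ j, -ε < eval z (h j)}) ∩
      {z | eval z f < fstar + ε}) ∩ {z ∈ Ω | J z ≤ -(ε / 2)}ᶜ with hO
  have hOo : IsOpen O := by
    refine IsOpen.inter (IsOpen.inter (IsOpen.inter ?_ ?_) ?_) (hsub _).isClosed.isOpen_compl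
    · rw [ofPred_forall]
      exact isOpen_iInter_of_finite fun i => isOpen_lt continuous_const (continuous_eval (g i))
    · rw [ofPred_forall]
      exact isOpen_iInter_of_finite fun j => isOpen_lt continuous_const (continuous_eval (h j))
    · exact isOpen_lt (continuous_eval f) continuous_const
  have hz₀O : z₀ ∈ O := by
    refine ⟨⟨⟨fun i => ?_, fun j => ?_⟩, hfz₀⟩, fun hz => ?_⟩
    · linarith [hgz₀ i]
    · linarith [hhz₀ j]
    · linarith [hz.2]
  have hz₀Ω : z₀ ∈ closure (Metric.ball 0 (√M)) := by
    rw [closure_ball _ hsM.ne', ← hball]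
    exact hBΩ (hB ▸ hhz₀)
  have hUpos : 0 < μ.real (O ∩ Ω) := by
    have hUvol : volume (O ∩ Ω) ≠ 0 := by
      have := (hOo.inter Metric.isOpen_ball).measure_pos volume
        (mem_closure_iff.1 hz₀Ω O hOo hz₀O)
      exact (this.trans_le (measure_mono
        (inter_subset_inter_right _ (hball ▸ Metric.ball_subset_closedBall)))).ne'
    refine ENNReal.toReal_pos ?_ (measure_ne_top _ _)
    rw [hμ, Measure.smul_apply, Measure.restrict_apply (hOo.measurableSet.inter
      hΩc.measurableSet), inter_assoc, inter_self]
    exact mul_ne_zero (ENNReal.inv_ne_zero.2 hvol) hUvol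
  obtain ⟨N, ⟨z, ⟨hzO, hzΩ⟩, hzJ⟩, hN⟩ := ((eventually_exists_sub_le hUpos hint hJkconv
    (half_pos hε)).and (eventually_ge_atTop 1)).exists
  obtain ⟨⟨⟨hzg, hzh⟩, hzf⟩, hzJ'⟩ := hzO
  have hJz : -(ε / 2) < J z := not_le.1 fun hle => hzJ' ⟨hzΩ, hle⟩
  have hzS : z ∈ Sk N := by
    rw [hSk]
    exact ⟨hzΩ, fun i => (hzg i).le, fun j => (hzh j).le, by linarith⟩
  refine ⟨N, hN, fun k hk => ⟨⟨N, hN, hk, z, hzS⟩, ?_⟩⟩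
  calc v k ≤ valPk N := by
        rw [hv]
        exact iInf₂_le N (Finset.mem_Icc.2 ⟨hN, hk⟩)
    _ ≤ ((eval z f : ℝ) : EReal) := by
        rw [hvalPk]
        exact sInf_le ⟨z, hzS, rfl⟩
    _ < _ := EReal.coe_lt_coe_iff.2 hzf
end
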